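/- arXiv:2111.08847 — 2 statements merged into one kernel-verified Lean document; each statement's English description precedes it below -/
import Mathlib

section
/- For all positive integers a, b and every positive integer c such that 2^c ≡ 1 (mod 3^a·11^b) (and 2^c > 2), the coefficient set A_{3^a,11^b,2^c} of the unitary cyclotomic polynomial Φ*_{3^a·11^b·2^c} equals {−1, 0, 1}. -/
open Polynomial

/-- The ternary inclusion-exclusion polynomial `Q_{p,q,r}`. -/
noncomputable def Qpoly (p q r : ℕ) : Polynomial ℤ :=
  ((X ^ (p * q * r) - 1) * (X ^ p - 1) * (X ^ q - 1) * (X ^ r - 1)) /ₘ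
    ((X ^ (p * q) - 1) * (X ^ (q * r) - 1) * (X ^ (r * p) - 1) * (X - 1))

/-- The set `A_{p,q,r}` of coefficients of `Q_{p,q,r}` (whose degree is `(p-1)(q-1)(r-1)`). -/
noncomputable def coeffSet (p q r : ℕ) : Set ℤ :=
  {n : ℤ | ∃ m : ℕ, m ≤ (p - 1) * (q - 1) * (r - 1) ∧ (Qpoly p q r).coeff m = n}

/-- The binary polynomial `(X ^ (p * q) - 1) * (X - 1) / ((X ^ p - 1) * (X ^ q - 1))` exists. -/
theorem exists_binary_mul_eq {p q : ℕ} (hpq : p.Coprime q) (hq : 1 < q) :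
    ∃ Φ : ℤ[X], Φ * ((X ^ p - 1) * (X ^ q - 1)) = (X ^ (p * q) - 1) * (X - 1) := by
  have hX : (X - 1 : ℤ[X]) ≠ 0 := by simpa using X_sub_C_ne_zero (1 : ℤ)
  have geom_dvd : ∀ m k : ℕ, (∑ i ∈ Finset.range m, (X : ℤ[X]) ^ i) ∣
      ∑ i ∈ Finset.range (m * k), (X : ℤ[X]) ^ i := fun m k => by
    rw [← mul_dvd_mul_iff_right hX, geom_sum_mul, geom_sum_mul, pow_mul]
    exact sub_one_dvd_pow_sub_one _ _
  obtain ⟨u, -, hu⟩ := Nat.exists_mul_mod_eq_one_of_coprime hpq hq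
  have hu' : p * u = q * (p * u / q) + 1 := by
    conv_lhs => rw [← Nat.div_add_mod (p * u) q, hu]
  have hcop : IsCoprime (∑ i ∈ Finset.range (p * u), (X : ℤ[X]) ^ i)
      (∑ i ∈ Finset.range (q * (p * u / q)), (X : ℤ[X]) ^ i) := by
    refine ⟨1, -X, mul_right_cancel₀ hX ?_⟩
    have h₁ := geom_sum_mul (X : ℤ[X]) (p * u)
    have h₂ := geom_sum_mul (X : ℤ[X]) (q * (p * u / q))
    have h₃ : (X : ℤ[X]) ^ (p * u) = X ^ (q * (p * u / q)) * X := by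
      rw [← pow_succ, ← hu']
    linear_combination h₁ - X * h₂ + h₃
  have hdvd := ((hcop.of_isCoprime_of_dvd_left (geom_dvd p u)).of_isCoprime_of_dvd_right
    (geom_dvd q _)).mul_dvd (geom_dvd p q) (mul_comm q p ▸ geom_dvd q p)
  obtain ⟨Φ, hΦ⟩ := hdvd
  refine ⟨Φ, ?_⟩
  rw [← geom_sum_mul X p, ← geom_sum_mul X q, ← geom_sum_mul X (p * q), hΦ]
  ring

/-- The coefficients of `(1 - X ^ p) * (1 - X ^ q) / (1 - X)`. -/
def boxCoeff (p q k : ℕ) : ℤ :=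
  1 - (if p ≤ k then 1 else 0) - (if q ≤ k then 1 else 0) + (if p + q ≤ k then 1 else 0)

theorem mk_one_mul_X_sub_one : (PowerSeries.mk (1 : ℕ → ℤ)) * (PowerSeries.X - 1) = -1 := by
  have := PowerSeries.mk_one_mul_one_sub_eq_one ℤ
  linear_combination -this

theorem coeff_mul_X_pow_sub_one (F : PowerSeries ℤ) (t n : ℕ) :
    PowerSeries.coeff n (F * (PowerSeries.X ^ t - 1)) =
      (if t ≤ n then PowerSeries.coeff (n - t) F else 0) - PowerSeries.coeff n F := by
  rw [mul_sub, mul_one, map_sub, PowerSeries.coeff_mul_X_pow']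

theorem mk_boxCoeff_mul (p q : ℕ) :
    PowerSeries.mk (boxCoeff p q) * (PowerSeries.X - 1) =
      -((PowerSeries.X ^ p - 1) * (PowerSeries.X ^ q - 1)) := by
  have h : PowerSeries.mk (boxCoeff p q) =
      PowerSeries.mk (1 : ℕ → ℤ) * (PowerSeries.X ^ p - 1) * (PowerSeries.X ^ q - 1) := by
    ext n
    rw [coeff_mul_X_pow_sub_one]
    simp only [coeff_mul_X_pow_sub_one, PowerSeries.coeff_mk, boxCoeff, Pi.one_apply]
    split_ifs <;> omega
  rw [h]
  linear_combination (PowerSeries.X ^ p - 1) * (PowerSeries.X ^ q - 1) * mk_one_mul_X_sub_one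

theorem mk_boxCoeff_mod_mul {p q : ℕ} (hpq : p + q ≤ p * q) :
    PowerSeries.mk (fun k => boxCoeff p q (k % (p * q))) *
      ((PowerSeries.X ^ (p * q) - 1) * (PowerSeries.X - 1)) =
      (PowerSeries.X ^ p - 1) * (PowerSeries.X ^ q - 1) := by
  have h : PowerSeries.mk (fun k => boxCoeff p q (k % (p * q))) * (PowerSeries.X ^ (p * q) - 1) =
      -PowerSeries.mk (boxCoeff p q) := by
    ext n
    rw [coeff_mul_X_pow_sub_one]
    simp only [PowerSeries.coeff_mk, map_neg]
    split_ifs with hn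
    · rw [← Nat.mod_eq_sub_mod hn, sub_self]
      unfold boxCoeff
      rw [if_pos, if_pos, if_pos] <;> omega
    · rw [Nat.mod_eq_of_lt (by omega)]; ring
  rw [← mul_assoc, h, neg_mul, mk_boxCoeff_mul, neg_neg]

/-- Away from the top coefficient, reducing modulo `p * q` does not wrap around. -/
theorem boxCoeff_sub_mod {p q r n m : ℕ} (hr : r ≡ 1 [MOD p * q]) (hmn : r * m ≤ n)
    (hm : m + p + q ≤ p * q) (hpos : 0 < p * q) :
    boxCoeff p q ((n - r * m) % (p * q)) =
      (if m ≤ n % (p * q) then 1 else 0) - (if m + p ≤ n % (p * q) then 1 else 0)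
        - (if m + q ≤ n % (p * q) then 1 else 0)
        + (if m + (p + q) ≤ n % (p * q) then 1 else 0) := by
  have hlt := Nat.mod_lt n hpos
  set N := n % (p * q) with hN
  have key : (n - r * m) + m ≡ N [MOD p * q] := by
    have h₁ : (n - r * m) + r * m ≡ N [MOD p * q] := by
      rw [Nat.sub_add_cancel hmn]; exact (Nat.mod_modEq _ _).symm
    have h₂ : r * m ≡ m [MOD p * q] := by simpa using hr.mul_right m
    exact (h₂.add_left _).symm.trans h₁
  by_cases hmN : m ≤ N
  · have : (n - r * m) % (p * q) = N - m := by
      have h : (n - r * m) + m ≡ (N - m) + m [MOD p * q] := by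
        rwa [Nat.sub_add_cancel hmN]
      have h' := Nat.ModEq.add_right_cancel' m h
      rw [h', Nat.mod_eq_of_lt (by omega)]
    rw [this, boxCoeff]
    split_ifs <;> omega
  · have : (n - r * m) % (p * q) = N + p * q - m := by
      have h : (n - r * m) + m ≡ (N + p * q - m) + m [MOD p * q] := by
        rw [Nat.sub_add_cancel (by omega)]
        exact key.trans (by simp [Nat.ModEq])
      have h' := Nat.ModEq.add_right_cancel' m h
      rw [h', Nat.mod_eq_of_lt (by omega)]
    rw [this, boxCoeff]
    split_ifs <;> omega

/-- The partial sums of the coefficients of a polynomial. -/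
noncomputable def partialSum (Φ : ℤ[X]) (n : ℕ) : ℤ := ∑ m ∈ Finset.range (n + 1), Φ.coeff m

theorem mk_partialSum_mul (Φ : ℤ[X]) :
    PowerSeries.mk (partialSum Φ) * (PowerSeries.X - 1) = -(Φ : PowerSeries ℤ) := by
  have h : PowerSeries.mk (partialSum Φ) = (Φ : PowerSeries ℤ) * PowerSeries.mk (1 : ℕ → ℤ) := by
    ext n
    rw [PowerSeries.coeff_mul, Finset.Nat.sum_antidiagonal_eq_sum_range_succ_mk]
    simp [partialSum]
  rw [h, mul_assoc, mk_one_mul_X_sub_one]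
  ring

theorem sum_coeff_ite (Φ : ℤ[X]) (M N t : ℕ) :
    ∑ m ∈ Finset.range (M + 1), Φ.coeff m * (if m + t ≤ N then 1 else 0) =
      if t ≤ N then partialSum Φ (min M (N - t)) else 0 := by
  simp only [mul_ite, mul_one, mul_zero]
  rw [← Finset.sum_filter]
  split_ifs with h
  · rw [partialSum]
    congr 1
    ext m
    simp only [Finset.mem_filter, Finset.mem_range]
    omega
  · refine Finset.sum_eq_zero fun m hm => ?_
    simp only [Finset.mem_filter] at hm
    omega

section Binary

variable {p q : ℕ} {Φ : ℤ[X]}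

theorem mk_partialSum_mul_of_binary
    (hΦ : Φ * ((X ^ p - 1) * (X ^ q - 1)) = (X ^ (p * q) - 1) * (X - 1)) :
    PowerSeries.mk (partialSum Φ) * (PowerSeries.X ^ p - 1) * (PowerSeries.X ^ q - 1) =
      -(PowerSeries.X ^ (p * q) - 1) := by
  have hX : (PowerSeries.X - 1 : PowerSeries ℤ) ≠ 0 := by
    intro h
    have := mk_one_mul_X_sub_one
    rw [h] at this
    simp at this
  refine mul_right_cancel₀ hX ?_
  have h := congrArg (fun f : ℤ[X] => (f : PowerSeries ℤ)) hΦ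
  push_cast at h
  linear_combination (PowerSeries.X ^ p - 1) * (PowerSeries.X ^ q - 1) * mk_partialSum_mul Φ - h

theorem partialSum_rec
    (hΦ : Φ * ((X ^ p - 1) * (X ^ q - 1)) = (X ^ (p * q) - 1) * (X - 1)) {n : ℕ}
    (hn : n < p * q) :
    partialSum Φ n - (if p ≤ n then partialSum Φ (n - p) else 0)
      - (if q ≤ n then partialSum Φ (n - q) else 0)
      + (if p + q ≤ n then partialSum Φ (n - (p + q)) else 0) = if n = 0 then 1 else 0 := by
  have h := congrArg (PowerSeries.coeff n) (mk_partialSum_mul_of_binary hΦ)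
  rw [coeff_mul_X_pow_sub_one, coeff_mul_X_pow_sub_one, coeff_mul_X_pow_sub_one] at h
  simp only [PowerSeries.coeff_mk, map_neg, map_sub, PowerSeries.coeff_X_pow,
    PowerSeries.coeff_one, hn.ne, if_false] at h
  have h₂ : n - q - p = n - (p + q) := by omega
  rw [h₂] at h
  split_ifs at h ⊢ <;> omega

theorem partialSum_sub_eq
    (hΦ : Φ * ((X ^ p - 1) * (X ^ q - 1)) = (X ^ (p * q) - 1) * (X - 1)) (hp : 0 < p)
    (hq : 0 < q) {n : ℕ} (hn : n < p * q) :
    partialSum Φ n - (if q ≤ n then partialSum Φ (n - q) else 0) = if p ∣ n then 1 else 0 := by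
  induction n using Nat.strong_induction_on with
  | _ n ih =>
    have h := partialSum_rec hΦ hn
    by_cases hpn : p ≤ n
    · have h' := ih (n - p) (by omega) (by omega)
      have h₁ : n - p - q = n - (p + q) := by omega
      rw [h₁] at h'
      have h₂ : p ∣ n - p ↔ p ∣ n := (Nat.dvd_sub_iff_left hpn dvd_rfl)
      simp only [h₂] at h'
      split_ifs at h h' ⊢ <;> omega
    · have h₂ : p ∣ n ↔ n = 0 := ⟨fun hd => Nat.eq_zero_of_dvd_of_lt hd (by omega), by simp_all⟩
      simp only [h₂]
      split_ifs at h ⊢ <;> omega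

/-- Below `p * q`, a nonzero partial sum is `1`, at an element of the numerical semigroup
generated by `p` and `q`. -/
theorem partialSum_eq_zero_or_one_and_rep
    (hΦ : Φ * ((X ^ p - 1) * (X ^ q - 1)) = (X ^ (p * q) - 1) * (X - 1)) (hpq : p.Coprime q)
    (hp : 0 < p) (hq : 0 < q) {n : ℕ} (hn : n < p * q) :
    partialSum Φ n = 0 ∨ (partialSum Φ n = 1 ∧ ∃ i j, n = p * i + q * j) := by
  induction n using Nat.strong_induction_on with
  | _ n ih =>
    have h := partialSum_sub_eq hΦ hp hq hn
    have hdvd : p ∣ n → ∃ i j, n = p * i + q * j := fun ⟨i, hi⟩ => ⟨i, 0, by simp [hi]⟩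
    by_cases hqn : q ≤ n
    · rw [if_pos hqn] at h
      rcases ih (n - q) (by omega) (by omega) with h₀ | ⟨h₁, i, j, hij⟩
      · split_ifs at h with hd
        · exact .inr ⟨by omega, hdvd hd⟩
        · exact .inl (by omega)
      · have hn' : n = p * i + q * (j + 1) := by rw [mul_add]; omega
        have hnd : ¬ p ∣ n := fun hd => by
          rw [hn', Nat.dvd_add_right (dvd_mul_right p i)] at hd
          have h₂ := Nat.le_of_dvd (Nat.succ_pos j) (hpq.dvd_of_dvd_mul_left hd)
          have h₃ := Nat.mul_le_mul_left q h₂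
          rw [mul_comm q p] at h₃
          have h₄ : q * (j + 1) ≤ n := by rw [hn']; exact Nat.le_add_left _ _
          exact absurd (h₃.trans h₄) (by omega)
        rw [if_neg hnd] at h
        exact .inr ⟨by omega, i, j + 1, hn'⟩
    · rw [if_neg hqn] at h
      split_ifs at h with hd
      · exact .inr ⟨by omega, hdvd hd⟩
      · exact .inl (by omega)

theorem partialSum_mem
    (hΦ : Φ * ((X ^ p - 1) * (X ^ q - 1)) = (X ^ (p * q) - 1) * (X - 1)) (hpq : p.Coprime q)
    (hp : 0 < p) (hq : 0 < q) {n : ℕ} (hn : n < p * q) :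
    partialSum Φ n = 0 ∨ partialSum Φ n = 1 :=
  (partialSum_eq_zero_or_one_and_rep hΦ hpq hp hq hn).imp_right And.left

theorem natDegree_binary
    (hΦ : Φ * ((X ^ p - 1) * (X ^ q - 1)) = (X ^ (p * q) - 1) * (X - 1)) (hp : 0 < p)
    (hq : 0 < q) : Φ.natDegree + (p + q) = p * q + 1 := by
  have hm : ∀ k : ℕ, 0 < k → (X ^ k - 1 : ℤ[X]).Monic ∧ (X ^ k - 1 : ℤ[X]).natDegree = k :=
    fun k hk => ⟨by simpa using monic_X_pow_sub_C (1 : ℤ) hk.ne',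
      by simpa using natDegree_X_pow_sub_C (n := k) (r := (1 : ℤ))⟩
  obtain ⟨mp, dp⟩ := hm p hp
  obtain ⟨mq, dq⟩ := hm q hq
  obtain ⟨mpq, dpq⟩ := hm (p * q) (Nat.mul_pos hp hq)
  obtain ⟨m1, d1⟩ := hm 1 one_pos
  rw [pow_one] at m1 d1
  have hΦ0 : Φ ≠ 0 := by
    rintro rfl
    rw [zero_mul] at hΦ
    exact (mpq.mul m1).ne_zero hΦ.symm
  have h := congrArg natDegree hΦ
  rwa [natDegree_mul hΦ0 (mp.mul mq).ne_zero, mp.natDegree_mul mq, mpq.natDegree_mul m1, dp, dq,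
    dpq, d1] at h

/-- The power series `Φ(X ^ r) / Φ(X)`. -/
noncomputable def ternarySeries (p q r : ℕ) (Φ : ℤ[X]) : PowerSeries ℤ :=
  (expand ℤ r Φ : ℤ[X]) * PowerSeries.mk (fun k => boxCoeff p q (k % (p * q)))

theorem coeff_ternarySeries (p q r : ℕ) (Φ : ℤ[X]) (n : ℕ) :
    PowerSeries.coeff n (ternarySeries p q r Φ) = ∑ m ∈ Finset.range (Φ.natDegree + 1),
      if r * m ≤ n then Φ.coeff m * boxCoeff p q ((n - r * m) % (p * q)) else 0 := by
  have h : (expand ℤ r Φ : PowerSeries ℤ) = ∑ m ∈ Finset.range (Φ.natDegree + 1),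
      PowerSeries.C (Φ.coeff m) * PowerSeries.X ^ (r * m) := by
    conv_lhs => rw [Φ.as_sum_range_C_mul_X_pow]
    rw [map_sum, ← Polynomial.coeToPowerSeries.ringHom_apply, map_sum]
    refine Finset.sum_congr rfl fun m _ => ?_
    rw [map_mul, expand_C, map_pow, expand_X, ← pow_mul, coeToPowerSeries.ringHom_apply, coe_mul,
      coe_C, coe_pow, coe_X]
  rw [ternarySeries, h, Finset.sum_mul, map_sum]
  refine Finset.sum_congr rfl fun m _ => ?_
  rw [mul_assoc, PowerSeries.coeff_C_mul, PowerSeries.coeff_X_pow_mul']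
  simp

theorem ternarySeries_one
    (hΦ : Φ * ((X ^ p - 1) * (X ^ q - 1)) = (X ^ (p * q) - 1) * (X - 1))
    (hle : p + q ≤ p * q) (hpos : 0 < p * q) : ternarySeries p q 1 Φ = 1 := by
  have hm : ((X ^ (p * q) - 1) * (X - 1) : ℤ[X]).Monic :=
    (by simpa using monic_X_pow_sub_C (1 : ℤ) hpos.ne' : (X ^ (p * q) - 1 : ℤ[X]).Monic).mul
      (by simpa using monic_X_sub_C (1 : ℤ))
  have h0 : (((X ^ (p * q) - 1) * (X - 1) : ℤ[X]) : PowerSeries ℤ) ≠ 0 :=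
    fun h => hm.ne_zero (coe_injective ℤ (by rw [h, coe_zero]))
  refine mul_right_cancel₀ h0 ?_
  have h := congrArg (fun f : ℤ[X] => (f : PowerSeries ℤ)) hΦ
  push_cast at h ⊢
  rw [ternarySeries, expand_one, mul_assoc, mk_boxCoeff_mod_mul hle, h, one_mul]

theorem coeff_ternarySeries_of_le
    (hΦ : Φ * ((X ^ p - 1) * (X ^ q - 1)) = (X ^ (p * q) - 1) * (X - 1))
    (hle : p + q ≤ p * q) (hpos : 0 < p * q) {r n : ℕ} (hr : r ≡ 1 [MOD p * q]) (hr0 : 0 < r)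
    (hn : r * Φ.natDegree ≤ n) (hn0 : n ≠ 0) :
    PowerSeries.coeff n (ternarySeries p q r Φ) = 0 := by
  have h := congrArg (PowerSeries.coeff n) (ternarySeries_one hΦ hle hpos)
  rw [PowerSeries.coeff_one, if_neg hn0, coeff_ternarySeries] at h
  rw [coeff_ternarySeries, ← h]
  refine Finset.sum_congr rfl fun m hm => ?_
  have hm' : r * m ≤ n :=
    (Nat.mul_le_mul_left r (Nat.le_of_lt_succ (Finset.mem_range.mp hm))).trans hn
  have hm1 : 1 * m ≤ n := (Nat.mul_le_mul_right m hr0).trans hm'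
  rw [if_pos hm', if_pos hm1]
  congr 2
  refine Nat.ModEq.add_right_cancel (hr.mul_right m) ?_
  rw [Nat.sub_add_cancel hm', Nat.sub_add_cancel hm1]

theorem coeff_ternarySeries_of_lt
    (hΦ : Φ * ((X ^ p - 1) * (X ^ q - 1)) = (X ^ (p * q) - 1) * (X - 1))
    (hp : 0 < p) (hq : 0 < q) {r n : ℕ} (hr : r ≡ 1 [MOD p * q]) (hr0 : 0 < r)
    (hn : n < r * Φ.natDegree) :
    PowerSeries.coeff n (ternarySeries p q r Φ) =
      partialSum Φ (min (n / r) (n % (p * q)))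
        - (if p ≤ n % (p * q) then partialSum Φ (min (n / r) (n % (p * q) - p)) else 0)
        - (if q ≤ n % (p * q) then partialSum Φ (min (n / r) (n % (p * q) - q)) else 0)
        + (if p + q ≤ n % (p * q) then partialSum Φ (min (n / r) (n % (p * q) - (p + q)))
            else 0) := by
  have hdeg := natDegree_binary hΦ hp hq
  have hM : n / r < Φ.natDegree := Nat.div_lt_of_lt_mul hn
  have h0 := sum_coeff_ite Φ (n / r) (n % (p * q)) 0
  rw [if_pos (Nat.zero_le _), Nat.sub_zero] at h0
  rw [coeff_ternarySeries, ← sum_coeff_ite, ← sum_coeff_ite, ← sum_coeff_ite, ← h0,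
    ← Finset.sum_sub_distrib, ← Finset.sum_sub_distrib, ← Finset.sum_add_distrib,
    ← Finset.sum_filter]
  refine Finset.sum_congr ?_ fun m hm => ?_
  · ext m
    have : r * m ≤ n ↔ m ≤ n / r := by rw [Nat.le_div_iff_mul_le hr0, mul_comm]
    simp only [Finset.mem_filter, Finset.mem_range, this]
    omega
  · rw [Finset.mem_range] at hm
    have hmn : r * m ≤ n := by
      rw [mul_comm, ← Nat.le_div_iff_mul_le hr0]; omega
    rw [boxCoeff_sub_mod hr hmn (by omega) (Nat.mul_pos hp hq)]
    simp only [add_zero]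
    ring

theorem coeff_ternarySeries_mem
    (hΦ : Φ * ((X ^ p - 1) * (X ^ q - 1)) = (X ^ (p * q) - 1) * (X - 1)) (hpq : p.Coprime q)
    (hp : 0 < p) (hq : 0 < q) {r n : ℕ} (hr : r ≡ 1 [MOD p * q]) (hr0 : 0 < r)
    (hn : n < r * Φ.natDegree) :
    PowerSeries.coeff n (ternarySeries p q r Φ) ∈ ({-1, 0, 1} : Set ℤ) := by
  have hlt := Nat.mod_lt n (Nat.mul_pos hp hq)
  have hrec := partialSum_rec hΦ hlt
  rw [coeff_ternarySeries_of_lt hΦ hp hq hr hr0 hn]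
  generalize n % (p * q) = N at *
  generalize n / r = M at *
  have hA : ∀ k ≤ N, partialSum Φ k = 0 ∨ partialSum Φ k = 1 := fun k hk =>
    partialSum_mem hΦ hpq hp hq (by omega)
  have h₀ := hA N le_rfl
  have h₁ := hA (N - p) (by omega)
  have h₂ := hA (N - q) (by omega)
  have h₃ := hA (N - (p + q)) (by omega)
  have h₄ := hA (min M N) (by omega)
  simp only [Set.mem_insert_iff, Set.mem_singleton_iff]
  rcases le_or_gt N M with h | h
  · rw [min_eq_right h, min_eq_right (by omega), min_eq_right (by omega),
      min_eq_right (by omega), hrec]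
    split_ifs <;> simp
  · rw [min_eq_left h.le] at h₄ ⊢
    have hmin : ∀ t, min M (N - t) = M ∨ min M (N - t) = N - t := fun t => by omega
    rcases hmin p with h₅ | h₅ <;> rcases hmin q with h₆ | h₆ <;>
      rcases hmin (p + q) with h₇ | h₇ <;> simp only [h₅, h₆, h₇] <;>
      split_ifs at hrec ⊢ <;> omega

/-- `Q_{p,q,r}` is `Φ(X ^ r) / Φ(X)`. -/
theorem coeff_Qpoly
    (hΦ : Φ * ((X ^ p - 1) * (X ^ q - 1)) = (X ^ (p * q) - 1) * (X - 1))
    (hle : p + q ≤ p * q) (hpos : 0 < p * q) {r : ℕ} (hr : r ≡ 1 [MOD p * q]) (hr0 : 0 < r)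
    (n : ℕ) : (Qpoly p q r).coeff n = PowerSeries.coeff n (ternarySeries p q r Φ) := by
  set Q := PowerSeries.trunc (r * Φ.natDegree + 1) (ternarySeries p q r Φ) with hQ
  have hcoe : (Q : PowerSeries ℤ) = ternarySeries p q r Φ := by
    ext k
    rw [coeff_coe, hQ, PowerSeries.coeff_trunc]
    split_ifs with hk
    · rfl
    · exact (coeff_ternarySeries_of_le hΦ hle hpos hr hr0 (by omega) (by omega)).symm
  have hmonic : ∀ k : ℕ, 0 < k → (X ^ k - 1 : ℤ[X]).Monic := fun k hk => by
    simpa using monic_X_pow_sub_C (1 : ℤ) hk.ne'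
  have hp : 0 < p := Nat.pos_of_mul_pos_right hpos
  have hq : 0 < q := Nat.pos_of_mul_pos_left hpos
  have hden : ((X ^ (p * q) - 1) * (X ^ (q * r) - 1) * (X ^ (r * p) - 1) * (X - 1) : ℤ[X]).Monic :=
    (((hmonic _ hpos).mul (hmonic _ (Nat.mul_pos hq hr0))).mul
      (hmonic _ (Nat.mul_pos hr0 hp))).mul (by simpa using hmonic 1 one_pos)
  have hmul : ((X ^ (p * q) - 1) * (X ^ (q * r) - 1) * (X ^ (r * p) - 1) * (X - 1) : ℤ[X]) * Q =
      (X ^ (p * q * r) - 1) * (X ^ p - 1) * (X ^ q - 1) * (X ^ r - 1) := by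
    apply Polynomial.coe_injective ℤ
    have h₁ := congrArg (fun f : ℤ[X] => ((expand ℤ r f : ℤ[X]) : PowerSeries ℤ)) hΦ
    have h₂ := mk_boxCoeff_mod_mul hle
    simp only [map_mul, map_sub, map_pow, map_one, expand_X, ← pow_mul] at h₁
    push_cast at h₁ ⊢
    rw [hcoe, ternarySeries]
    rw [mul_comm r p, mul_comm q r, mul_comm (p * q) r]
    rw [mul_comm r p] at h₁
    linear_combination
      (PowerSeries.mk fun k => boxCoeff p q (k % (p * q))) * (PowerSeries.X ^ (p * q) - 1)
        * (PowerSeries.X - 1) * h₁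
      + (PowerSeries.X ^ (r * (p * q)) - 1) * (PowerSeries.X ^ r - 1) * h₂
  rw [Qpoly, ← hmul, mul_divByMonic_cancel_left _ hden, ← hcoe, coeff_coe]

end Binary

/-- If `r ≡ 1` modulo `p * q` then `Q_{p,q,r}` is flat. -/
theorem coeffSet_eq_of_modEq_one {p q r : ℕ} (hpq : p.Coprime q) (hp : 2 < p) (hq : 2 < q)
    (hr : r ≡ 1 [MOD p * q]) (hr1 : 1 < r) : coeffSet p q r = {-1, 0, 1} := by
  obtain ⟨Φ, hΦ⟩ := exists_binary_mul_eq hpq (by omega)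
  have hle : p + q ≤ p * q := by nlinarith
  have hpos : 0 < p * q := by omega
  have hdeg := natDegree_binary hΦ (by omega) (by omega)
  have hdeg' : Φ.natDegree = (p - 1) * (q - 1) := by
    obtain ⟨p, rfl⟩ := Nat.exists_eq_add_of_lt hp
    obtain ⟨q, rfl⟩ := Nat.exists_eq_add_of_lt hq
    simp only [Nat.add_sub_cancel]
    nlinarith
  have hrpq : p * q < r := by
    have h := (Nat.modEq_iff_dvd' hr1.le).mp hr.symm
    have := Nat.le_of_dvd (by omega) h
    omega
  have hne : p ≠ q := by
    rintro rfl
    rw [Nat.coprime_self] at hpq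
    omega
  have hd : 4 ≤ Φ.natDegree := by
    rw [hdeg']; exact Nat.mul_le_mul (by omega : 2 ≤ p - 1) (by omega : 2 ≤ q - 1)
  have hA0 : partialSum Φ 0 = 1 := by
    have h := partialSum_rec hΦ hpos
    simpa [show p ≠ 0 by omega, show q ≠ 0 by omega] using h
  have hsmall : ∀ n < p * q, (Qpoly p q r).coeff n = boxCoeff p q n := fun n hn => by
    rw [coeff_Qpoly hΦ hle hpos hr (by omega),
      coeff_ternarySeries_of_lt hΦ (by omega) (by omega) hr (by omega) (by nlinarith),
      Nat.div_eq_of_lt (hn.trans hrpq), Nat.mod_eq_of_lt hn]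
    simp [hA0, boxCoeff]
  have hbound : p * q ≤ (p - 1) * (q - 1) * (r - 1) := by
    rw [← hdeg']
    nlinarith [show p * q ≤ r - 1 by omega]
  ext z
  constructor
  · rintro ⟨n, hn, rfl⟩
    rw [coeff_Qpoly hΦ hle hpos hr (by omega)]
    refine coeff_ternarySeries_mem hΦ hpq (by omega) (by omega) hr (by omega) ?_
    rw [← hdeg', mul_comm] at hn
    exact hn.trans_lt (Nat.mul_lt_mul_of_pos_right (by omega) (by omega))
  · have hwit : ∀ n < p * q, boxCoeff p q n = z → z ∈ coeffSet p q r := fun n hn h =>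
      ⟨n, by omega, by rw [hsmall n hn, h]⟩
    rintro (rfl | rfl | rfl)
    · refine hwit (max p q) (by omega) ?_
      unfold boxCoeff
      split_ifs <;> omega
    · refine hwit (min p q) (by omega) ?_
      unfold boxCoeff
      split_ifs <;> omega
    · refine hwit 0 hpos ?_
      unfold boxCoeff
      split_ifs <;> omega

theorem stmt_18 : ∀ a b c : ℕ, 0 < a → 0 < b → 0 < c →
    2 ^ c ≡ 1 [MOD 3 ^ a * 11 ^ b] → 2 < 2 ^ c →
    coeffSet (3 ^ a) (11 ^ b) (2 ^ c) = ({-1, 0, 1} : Set ℤ) := by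
  intro a b c ha hb hc hr hc2
  have h₃ : 3 ^ 1 ≤ 3 ^ a := Nat.pow_le_pow_right (by norm_num) ha
  have h₁₁ : 11 ^ 1 ≤ 11 ^ b := Nat.pow_le_pow_right (by norm_num) hb
  exact coeffSet_eq_of_modEq_one (Nat.Coprime.pow a b (by norm_num)) (by omega) (by omega) hr
    (by omega)
end

section
/- Let p and q be primes with p < q such that p ≡ q (mod 8), p ≡ 3 or 7 (mod 8), gcd(p−1, q−1) = 2, q is a primitive root modulo p², and let r be a prime that is a primitive root modulo p² and modulo q². Then for every exponent a ≥ 1 there exist exponents b and c (with p^a, q^b, r^c > 2) such that the diameter of the coefficient set A_{p^a,q^b,r^c} of Φ*_{p^a q^b r^c} (the largest coefficient minus the smallest coefficient) equals exactly p^a. -/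
open Polynomial

/-- `g` is a primitive root modulo `m`: it generates the multiplicative group of `ZMod m`. -/
def IsPrimRootMod (g m : ℕ) : Prop :=
  IsUnit (g : ZMod m) ∧ ∀ x : (ZMod m)ˣ, ∃ i : ℕ, (g : ZMod m) ^ i = (x : ZMod m)

theorem IsPrimRootMod.of_dvd {g m d : ℕ} [NeZero m] (h : IsPrimRootMod g m) (hd : d ∣ m) :
    IsPrimRootMod g d := by
  refine ⟨?_, fun x => ?_⟩
  · simpa using h.1.map (ZMod.castHom hd (ZMod d))
  · obtain ⟨y, rfl⟩ := ZMod.unitsMap_surjective hd x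
    obtain ⟨i, hi⟩ := h.2 y
    refine ⟨i, ?_⟩
    have := congrArg (ZMod.castHom hd (ZMod d)) hi
    rw [map_pow, map_natCast] at this
    simpa [ZMod.unitsMap] using this

theorem IsPrimRootMod.orderOf_unit {g m : ℕ} {u : (ZMod m)ˣ} (h : IsPrimRootMod g m)
    (hu : (u : ZMod m) = g) : orderOf u = Nat.card (ZMod m)ˣ := by
  refine orderOf_eq_card_of_forall_mem_zpowers fun x => ?_
  obtain ⟨i, hi⟩ := h.2 x
  exact ⟨i, by ext; simpa [hu] using hi⟩

theorem IsPrimRootMod.prime_pow {g p n : ℕ} (hp : p.Prime) (hp2 : p ≠ 2)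
    (h : IsPrimRootMod g (p ^ 2)) : IsPrimRootMod g (p ^ n) := by
  have : NeZero p := ⟨hp.ne_zero⟩
  obtain hn | hn := le_total n 2
  · exact h.of_dvd (pow_dvd_pow p hn)
  have hdvd : p ^ 2 ∣ p ^ n := pow_dvd_pow p hn
  have hcop : g.Coprime p := by
    have := (ZMod.isUnit_iff_coprime g (p ^ 2)).1 h.1
    exact (Nat.coprime_pow_right_iff two_pos g p).1 this
  have hg : IsUnit (g : ZMod (p ^ n)) :=
    (ZMod.isUnit_iff_coprime g (p ^ n)).2 (hcop.pow_right n)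
  obtain ⟨u, hu⟩ := hg
  have := ZMod.isCyclic_units_of_prime_pow p hp hp2 n
  obtain ⟨c, hc⟩ := IsCyclic.exists_generator (α := (ZMod (p ^ n))ˣ)
  obtain ⟨t, rfl⟩ := Submonoid.mem_powers_iff _ _ |>.1 (mem_powers_iff_mem_zpowers.2 (hc u))
  have hcard : ∀ k, 0 < k → Nat.card (ZMod (p ^ k))ˣ = p ^ (k - 1) * (p - 1) := fun k hk => by
    rw [Nat.card_eq_fintype_card, ZMod.card_units_eq_totient, Nat.totient_prime_pow hp hk]
  have hc' : ∀ x, x ∈ Subgroup.zpowers (ZMod.unitsMap hdvd c) := fun x => by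
    obtain ⟨y, rfl⟩ := ZMod.unitsMap_surjective hdvd x
    obtain ⟨i, rfl⟩ := hc y
    exact ⟨i, by simp⟩
  have hord := orderOf_eq_card_of_forall_mem_zpowers hc'
  have hord' : orderOf (ZMod.unitsMap hdvd c ^ t) = Nat.card (ZMod (p ^ 2))ˣ := by
    rw [← map_pow]
    refine h.orderOf_unit ?_
    have := congrArg (ZMod.castHom hdvd (ZMod (p ^ 2))) hu
    exact (Units.coe_map _ _).trans (this.trans (map_natCast _ _))
  have ht : (Nat.card (ZMod (p ^ 2))ˣ).Coprime t := by
    rw [orderOf_pow, hord] at hord'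
    have h0 : 0 < Nat.card (ZMod (p ^ 2))ˣ := Nat.card_pos
    exact (Nat.div_eq_self.1 hord').resolve_left h0.ne'
  have ht' : (orderOf c).Coprime t := by
    rw [orderOf_eq_card_of_forall_mem_zpowers hc, hcard n (by omega)]
    rw [hcard 2 two_pos, Nat.coprime_mul_iff_left] at ht
    exact Nat.Coprime.mul_left (Nat.Coprime.pow_left _ (by simpa using ht.1)) ht.2
  refine ⟨⟨_, hu⟩, fun x => ?_⟩
  have hgen : ∀ y, y ∈ Subgroup.zpowers (c ^ t) := by
    have := Subgroup.eq_top_of_card_eq (Subgroup.zpowers (c ^ t)) (by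
      rw [Nat.card_zpowers, ht'.orderOf_pow, orderOf_eq_card_of_forall_mem_zpowers hc])
    simp [this]
  obtain ⟨i, hi⟩ := Submonoid.mem_powers_iff _ _ |>.1 (mem_powers_iff_mem_zpowers.2 (hgen x))
  exact ⟨i, by rw [← hu, ← hi]; simp⟩

theorem IsPrimRootMod.exists_pow_modEq {g m x : ℕ} (h : IsPrimRootMod g m) (hx : x.Coprime m) :
    ∃ i, g ^ i ≡ x [MOD m] := by
  obtain ⟨i, hi⟩ := h.2 (ZMod.unitOfCoprime x hx)
  refine ⟨i, (ZMod.natCast_eq_natCast_iff _ _ _).1 ?_⟩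
  simpa using hi

theorem IsPrimRootMod.not_isSquare {g p : ℕ} [Fact p.Prime] (h : IsPrimRootMod g p)
    (h4 : p % 4 = 3) : ¬ IsSquare (g : ZMod p) := fun hs => by
  obtain ⟨i, hi⟩ := h.2 (-1)
  refine ZMod.exists_sq_eq_neg_one_iff.1 ?_ h4
  have := hs.pow i
  rw [hi] at this
  simpa using this

theorem IsPrimRootMod.even_of_two_mul_pow_modEq_one {g p i : ℕ} (hp : p.Prime)
    (h : IsPrimRootMod g p) (h8 : p % 8 = 3 ∨ p % 8 = 7) (hi : 2 * g ^ i ≡ 1 [MOD p]) :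
    Even i ↔ p % 8 = 7 := by
  have := Fact.mk hp
  have hp2 : p ≠ 2 := by omega
  have hg := h.not_isSquare (by omega)
  have hi' : (2 : ZMod p) * (g : ZMod p) ^ i = 1 := by
    simpa using (ZMod.natCast_eq_natCast_iff _ _ _).2 hi
  have hg0 : (g : ZMod p) ≠ 0 := h.1.ne_zero
  have h20 : (2 : ZMod p) ≠ 0 := left_ne_zero_of_mul_eq_one hi'
  have hchar : quadraticChar (ZMod p) 2 * quadraticChar (ZMod p) g ^ i = 1 := by
    rw [← map_pow, ← map_mul, hi', map_one]
  rw [quadraticChar_neg_one_iff_not_isSquare.2 hg] at hchar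
  have h2 := ZMod.exists_sq_eq_two_iff hp2
  constructor
  · intro he
    rw [he.neg_one_pow, mul_one] at hchar
    have := h2.1 ((quadraticChar_one_iff_isSquare h20).1 hchar)
    omega
  · intro h7
    rw [(quadraticChar_one_iff_isSquare h20).2 (h2.2 (Or.inr h7)), one_mul] at hchar
    exact (neg_one_pow_eq_one_iff_even (by norm_num)).1 hchar

theorem exists_prime_pow_eq_mul_add_two {p q a : ℕ} (hp : p.Prime) (hq : q.Prime)
    (hp2 : p ≠ 2) (hq2 : q ≠ 2) (ha : 1 ≤ a) (h : IsPrimRootMod q (p ^ 2)) :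
    ∃ b k, 0 < b ∧ Odd k ∧ q ^ b = k * p ^ a + 2 := by
  have hodd : Odd (p ^ a) := (hp.odd_of_ne_two hp2).pow
  have hpa : 3 ≤ p ^ a := by
    have := Nat.le_self_pow (n := a) (by omega) p
    have := hp.two_le
    omega
  obtain ⟨b, hb⟩ := (h.prime_pow (n := a) hp hp2).exists_pow_modEq
    (Nat.coprime_two_left.2 hodd)
  have hb0 : b ≠ 0 := by
    rintro rfl
    have := hb.eq_of_lt_of_lt (by simp; omega) (by omega)
    simp at this
  have hqb : q ≤ q ^ b := Nat.le_self_pow hb0 q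
  have hle : 2 ≤ q ^ b := hq.two_le.trans hqb
  obtain ⟨k, hk⟩ := (Nat.modEq_iff_dvd' hle).1 hb.symm
  have hqodd : Odd (q ^ b) := (hq.odd_of_ne_two hq2).pow
  have heq : q ^ b = k * p ^ a + 2 := by rw [mul_comm]; omega
  refine ⟨b, k, Nat.pos_of_ne_zero hb0, ?_, heq⟩
  rw [heq, Nat.odd_add] at hqodd
  exact (Nat.odd_mul.1 (hqodd.2 even_two)).1

theorem exists_large_pow_two_mul_modEq_one {p q r : ℕ} (hp : p.Prime) (hq : q.Prime)
    (hr : r.Prime) (hlt : p < q) (h8 : p % 8 = q % 8) (h8' : p % 8 = 3 ∨ p % 8 = 7)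
    (hgcd : Nat.gcd (p - 1) (q - 1) = 2) (hqp : ¬ q ≡ 1 [MOD p])
    (hrroot1 : IsPrimRootMod r (p ^ 2)) (hrroot2 : IsPrimRootMod r (q ^ 2))
    {a b : ℕ} (ha : 0 < a) (hb : 0 < b) :
    ∃ c, 0 < c ∧ p ^ a * q ^ b ≤ r ^ c ∧ 2 * r ^ c ≡ 1 [MOD p ^ a * q ^ b] := by
  have hp2 : p ≠ 2 := by omega
  have hq2 : q ≠ 2 := by omega
  have key : ∀ {s n : ℕ}, s.Prime → s ≠ 2 → IsPrimRootMod r (s ^ 2) →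
      ∃ i, 2 * r ^ i ≡ 1 [MOD s ^ n] := fun {s n} hs hs2 h => by
    have hodd : Odd (s ^ n) := (hs.odd_of_ne_two hs2).pow
    obtain ⟨l, hl⟩ := hodd.add_one
    have h1 : 2 * l ≡ 1 [MOD s ^ n] := by
      have : 2 * l = s ^ n + 1 := by omega
      rw [this]; simp [Nat.ModEq]
    have hcop : l.Coprime (s ^ n) := by
      have : (2 * l).Coprime (s ^ n) := by
        rw [Nat.Coprime, h1.gcd_eq]; simp
      exact Nat.Coprime.coprime_mul_left this
    obtain ⟨i, hi⟩ := (h.prime_pow (n := n) hs hs2).exists_pow_modEq hcop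
    exact ⟨i, (hi.mul_left 2).trans h1⟩
  obtain ⟨i, hi⟩ := key (n := a) hp hp2 hrroot1
  obtain ⟨j, hj⟩ := key (n := b) hq hq2 hrroot2
  have hipar := (pow_one p ▸ hrroot1.prime_pow (n := 1) hp hp2).even_of_two_mul_pow_modEq_one hp h8'
    (hi.of_dvd (dvd_pow_self p ha.ne'))
  have hjpar := (pow_one q ▸ hrroot2.prime_pow (n := 1) hq hq2).even_of_two_mul_pow_modEq_one hq
    (h8 ▸ h8') (hj.of_dvd (dvd_pow_self q hb.ne'))
  have hpar : i ≡ j [MOD 2] := by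
    rw [h8, ← hjpar, Nat.even_iff, Nat.even_iff] at hipar
    unfold Nat.ModEq
    omega
  have hqp1 : q.Coprime (p - 1) :=
    Nat.coprime_of_lt_prime (by have := hp.two_le; omega) (by omega) hq
  have hpq1 : p.Coprime (q - 1) := (Nat.Prime.coprime_iff_not_dvd hp).2 fun h =>
    hqp ((Nat.modEq_iff_dvd' hq.one_lt.le).2 h).symm
  have hpq : p.Coprime q := (Nat.coprime_primes hp hq).2 hlt.ne
  have htot : (p ^ a).totient.gcd (q ^ b).totient = 2 := by
    rw [Nat.totient_prime_pow hp ha, Nat.totient_prime_pow hq hb,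
      Nat.Coprime.gcd_mul_left_cancel, Nat.Coprime.gcd_mul_left_cancel_right, hgcd]
    · exact (hqp1.pow_left _)
    · exact Nat.Coprime.mul_right ((hpq.pow_left _).pow_right _) (hpq1.pow_left _)
  obtain ⟨c, hci, hcj⟩ := Nat.chineseRemainder' (n := (p ^ a).totient) (m := (q ^ b).totient)
    (a := i) (b := j) (by rwa [htot])
  have hcop : ∀ {s : ℕ} (n : ℕ), IsPrimRootMod r (s ^ 2) → r.Coprime (s ^ n) := fun {s} n h =>
    ((Nat.coprime_pow_right_iff two_pos r s).1
      ((ZMod.isUnit_iff_coprime r (s ^ 2)).1 h.1)).pow_right n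
  have hpow : ∀ {m u v : ℕ}, r.Coprime m → u ≡ v [MOD m.totient] → r ^ u ≡ r ^ v [MOD m] := by
    intro m u v hm huv
    have h1 := Nat.ModEq.pow_totient hm
    wlog huv' : u ≤ v generalizing u v
    · exact (this huv.symm (by omega)).symm
    obtain ⟨t, ht⟩ := (Nat.modEq_iff_dvd' huv').1 huv
    obtain rfl : v = u + m.totient * t := by omega
    rw [pow_add, pow_mul]
    simpa using ((h1.pow t).mul_left (r ^ u)).symm
  set N := p ^ a * q ^ b
  have hN : 0 < N := Nat.mul_pos (pow_pos hp.pos a) (pow_pos hq.pos b)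
  set e := c + N * ((p ^ a).totient * (q ^ b).totient) with he
  have hφ : 0 < (p ^ a).totient * (q ^ b).totient :=
    Nat.mul_pos (Nat.totient_pos.2 (pow_pos hp.pos a)) (Nat.totient_pos.2 (pow_pos hq.pos b))
  have hNe : N ≤ e := (Nat.le_mul_of_pos_right N hφ).trans (Nat.le_add_left _ _)
  refine ⟨e, hN.trans_le hNe, hNe.trans (Nat.lt_pow_self hr.one_lt).le, ?_⟩
  refine (Nat.modEq_and_modEq_iff_modEq_mul ((hpq.pow_left a).pow_right b)).1 ⟨?_, ?_⟩
  · refine ((hpow (hcop a hrroot1) ?_).mul_left 2).trans hi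
    refine Nat.ModEq.trans ?_ hci
    simp [he, Nat.ModEq, mul_left_comm N]
  · refine ((hpow (hcop b hrroot2) ?_).mul_left 2).trans hj
    refine Nat.ModEq.trans ?_ hcj
    simp [he, Nat.ModEq, ← mul_assoc]

theorem IsPrimRootMod.not_modEq_one {g p : ℕ} (hp : p.Prime) (hp2 : p ≠ 2)
    (h : IsPrimRootMod g p) : ¬ g ≡ 1 [MOD p] := fun h1 => by
  have hg : (g : ZMod p) = 1 := by simpa using (ZMod.natCast_eq_natCast_iff _ _ _).2 h1
  obtain ⟨i, hi⟩ := h.2 (-1)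
  have : Fact (2 < p) := ⟨by have := hp.two_le; omega⟩
  refine ZMod.neg_one_ne_one (n := p) ?_
  simpa [hg] using hi.symm

open Finset in
/-- The sum of `φ` over the exponents of the binary polynomial
`(X ^ (P * Q) - 1) * (X - 1) / ((X ^ P - 1) * (X ^ Q - 1))`, weighted by its coefficients, for
`P = 2 * l + 1` and `Q = k * P + 2`. -/
def binarySum {S : Type*} [AddCommGroup S] (P Q l k : ℕ) (φ : ℕ → S) : S :=
  ∑ x ∈ range (k * l + 1), ∑ y ∈ range (l + 1), φ (P * x + Q * y) -
    ∑ x ∈ range (k * (l + 1) + 1), ∑ y ∈ range l, φ (P * x + Q * y + 1)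

section binarySum

variable {P Q l k : ℕ}

theorem map_binarySum {S T F : Type*} [AddCommGroup S] [AddCommGroup T] [FunLike F S T]
    [AddMonoidHomClass F S T] (f : F) (φ : ℕ → S) :
    f (binarySum P Q l k φ) = binarySum P Q l k (fun m => f (φ m)) := by
  simp [binarySum, map_sub, map_sum]

theorem binarySum_add {S : Type*} [AddCommGroup S] (φ ψ : ℕ → S) :
    binarySum P Q l k (φ + ψ) = binarySum P Q l k φ + binarySum P Q l k ψ := by
  simp only [binarySum, Pi.add_apply, Finset.sum_add_distrib]
  abel

theorem binarySum_sub {S : Type*} [AddCommGroup S] (φ ψ : ℕ → S) :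
    binarySum P Q l k (φ - ψ) = binarySum P Q l k φ - binarySum P Q l k ψ := by
  simp only [binarySum, Pi.sub_apply, Finset.sum_sub_distrib]
  abel

theorem binarySum_mul {S : Type*} [CommRing S] (φ : ℕ → S) (s : S) :
    binarySum P Q l k φ * s = binarySum P Q l k (fun m => φ m * s) := by
  simp [binarySum, sub_mul, Finset.sum_mul]

theorem binarySum_congr {S : Type*} [AddCommGroup S] (hP : P = 2 * l + 1) (hQ : Q = k * P + 2)
    {φ ψ : ℕ → S} (h : ∀ m, m + P + Q ≤ P * Q + 1 → φ m = ψ m) :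
    binarySum P Q l k φ = binarySum P Q l k ψ := by
  unfold binarySum
  congr 1
  all_goals
    refine Finset.sum_congr rfl fun x hx => Finset.sum_congr rfl fun y hy => h _ ?_
    rw [Finset.mem_range] at hx hy
    have h1 := Nat.mul_le_mul_left P (Nat.succ_le_of_lt hx)
    have h2 := Nat.mul_le_mul_left Q (Nat.succ_le_of_lt hy)
    have h3 : P * (k * l + 1) + Q * (l + 1) = P * Q + 1 := by subst hQ hP; ring
    have h4 : P * (k * (l + 1) + 1) + Q * l + 1 = P * Q := by subst hQ hP; ring
    simp only [Nat.succ_eq_add_one, mul_add, mul_one] at *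
    omega

theorem binarySum_pow_mul {S : Type*} [CommRing S] (hP : P = 2 * l + 1) (hQ : Q = k * P + 2)
    (y : S) : binarySum P Q l k (fun m => y ^ m) * ((y ^ P - 1) * (y ^ Q - 1)) =
      (y ^ (P * Q) - 1) * (y - 1) := by
  have hbox : ∀ (a b c : ℕ), ∑ i ∈ Finset.range a, ∑ j ∈ Finset.range b, y ^ (P * i + Q * j + c) =
      (∑ i ∈ Finset.range a, (y ^ P) ^ i) * (∑ j ∈ Finset.range b, (y ^ Q) ^ j) * y ^ c := by
    intro a b c
    rw [Finset.sum_mul_sum, Finset.sum_mul]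
    simp only [Finset.sum_mul, pow_add, pow_mul]
  have h1 := hbox (k * l + 1) (l + 1) 0
  have h2 := hbox (k * (l + 1) + 1) l 1
  simp only [add_zero, pow_zero, mul_one, pow_one] at h1 h2
  rw [binarySum, h1, h2]
  have e1 := geom_sum_mul (y ^ P) (k * l + 1)
  have e2 := geom_sum_mul (y ^ Q) (l + 1)
  have e3 := geom_sum_mul (y ^ P) (k * (l + 1) + 1)
  have e4 := geom_sum_mul (y ^ Q) l
  have f1 : (y ^ P) ^ (k * l + 1) * (y ^ Q) ^ (l + 1) = y ^ (P * Q) * y := by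
    rw [← pow_mul, ← pow_mul, ← pow_add, ← pow_succ]; congr 1; subst hQ hP; ring
  have f2 : y * (y ^ P) ^ (k * (l + 1) + 1) = (y ^ Q) ^ (l + 1) := by
    rw [← pow_mul, ← pow_mul, ← pow_succ']; congr 1; subst hQ hP; ring
  have f3 : y * (y ^ Q) ^ l = (y ^ P) ^ (k * l + 1) := by
    rw [← pow_mul, ← pow_mul, ← pow_succ']; congr 1; subst hQ hP; ring
  have f4 : y * (y ^ P) ^ (k * (l + 1) + 1) * (y ^ Q) ^ l = y ^ (P * Q) := by
    rw [← pow_mul, ← pow_mul, ← pow_succ', ← pow_add]; congr 1; subst hQ hP; ring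
  generalize ∑ i ∈ Finset.range (k * l + 1), (y ^ P) ^ i = s1 at *
  generalize ∑ i ∈ Finset.range (l + 1), (y ^ Q) ^ i = s2 at *
  generalize ∑ i ∈ Finset.range (k * (l + 1) + 1), (y ^ P) ^ i = s3 at *
  generalize ∑ i ∈ Finset.range l, (y ^ Q) ^ i = s4 at *
  calc _ = (s1 * (y ^ P - 1)) * (s2 * (y ^ Q - 1)) -
        y * (s3 * (y ^ P - 1)) * (s4 * (y ^ Q - 1)) := by ring
    _ = _ := by rw [e1, e2, e3, e4]; linear_combination f1 + f2 + f3 - f4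

theorem binarySum_pow_mul_geom_sum_sq (hP : P = 2 * l + 1) (hQ : Q = k * P + 2) :
    binarySum P Q l k (fun m => (X : ℤ[X]) ^ m) * ∑ i ∈ Finset.range P, (X ^ 2) ^ i =
      (∑ i ∈ Finset.range P, (X ^ Q) ^ i) * ∑ i ∈ Finset.range P, (-X) ^ i := by
  have hne : ∀ n, 0 < n → (X ^ n - 1 : ℤ[X]) ≠ 0 := fun n hn => X_pow_sub_C_ne_zero hn 1
  have hodd : Odd P := ⟨l, hP⟩
  have e1 := binarySum_pow_mul hP hQ (X : ℤ[X])
  have e2 := geom_sum_mul ((X : ℤ[X]) ^ 2) P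
  have e3 := geom_sum_mul ((X : ℤ[X]) ^ Q) P
  have e4 := geom_sum_mul (-X : ℤ[X]) P
  rw [hodd.neg_pow] at e4
  rw [← pow_mul] at e2 e3
  rw [mul_comm Q P] at e3
  refine mul_right_cancel₀ (mul_ne_zero (mul_ne_zero (hne P (by omega)) (hne Q (by omega)))
    (hne 2 two_pos)) ?_
  rw [show ∀ a b c d e : ℤ[X], a * b * (c * d * e) = (a * (c * d)) * (b * e) by
    intros; ring, e1, e2, ← e3, pow_mul']
  linear_combination ((∑ i ∈ Finset.range P, (X ^ Q) ^ i) * (X ^ Q - 1) * (X ^ P - 1) *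
    (X - 1)) * e4

theorem dvd_binarySum_mul {R : ℕ} (hP : P = 2 * l + 1) (hQ : Q = k * P + 2)
    (hR : 2 * R ≡ 1 [MOD P * Q]) :
    (X ^ (P * Q) - 1 : ℤ[X]) ∣ binarySum P Q l k (fun m => ((X : ℤ[X]) ^ R) ^ m) *
      ((∑ i ∈ Finset.range P, X ^ i) * (1 - X ^ Q)) := by
  rw [← Ideal.mem_span_singleton, ← Ideal.Quotient.eq_zero_iff_mem]
  set π := Ideal.Quotient.mk (Ideal.span {(X ^ (P * Q) - 1 : ℤ[X])}) with hπ
  set x := π X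
  have hx : x ^ (P * Q) = 1 := by
    rw [← map_pow, ← sub_eq_zero, ← map_one π, ← map_sub, hπ, Ideal.Quotient.eq_zero_iff_mem]
    exact Ideal.mem_span_singleton_self _
  have hxy : (x ^ R) ^ 2 = x := by
    rw [pow_right_comm, ← pow_mul, ← pow_one x, ← pow_mul, one_mul]
    exact pow_eq_pow_of_modEq hR hx
  have hy : (x ^ R) ^ (P * Q) = 1 := by rw [pow_right_comm, hx, one_pow]
  have key := congrArg (aeval (x ^ R)) (binarySum_pow_mul_geom_sum_sq (l := l) (k := k) hP hQ)
  rw [map_mul, map_binarySum] at key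
  simp only [map_mul, map_sum, map_pow, aeval_X, map_neg, hxy] at key
  have hg := geom_sum_mul ((x ^ R) ^ Q) P
  rw [← pow_mul _ Q P, mul_comm Q P, hy, sub_self] at hg
  rw [map_mul, map_binarySum]
  simp only [map_mul, map_sum, map_pow, map_sub, map_one]
  change binarySum P Q l k (fun m => (x ^ R) ^ m) * ((∑ i ∈ Finset.range P, x ^ i) * (1 - x ^ Q)) = 0
  have hxQ : x ^ Q = ((x ^ R) ^ Q) ^ 2 := by rw [pow_right_comm, hxy]
  rw [← mul_assoc, key, hxQ]
  linear_combination (-(∑ i ∈ Finset.range P, (-x ^ R) ^ i) * (1 + (x ^ R) ^ Q)) * hg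

theorem monic_Qpoly_denominator {P Q R : ℕ} (hP : 0 < P) (hQ : 0 < Q) (hR : 0 < R) :
    ((X ^ (P * Q) - 1) * (X ^ (Q * R) - 1) * (X ^ (R * P) - 1) * (X - 1) : ℤ[X]).Monic := by
  have h : ∀ n, 0 < n → (X ^ n - 1 : ℤ[X]).Monic := fun n hn => monic_X_pow_sub_C 1 hn.ne'
  exact (((h _ (Nat.mul_pos hP hQ)).mul (h _ (Nat.mul_pos hQ hR))).mul
    (h _ (Nat.mul_pos hR hP))).mul (monic_X_sub_C 1)

theorem natDegree_Qpoly {P Q R : ℕ} (hP : 0 < P) (hQ : 0 < Q) (hR : 0 < R) :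
    (Qpoly P Q R).natDegree = (P - 1) * (Q - 1) * (R - 1) := by
  have h : ∀ n, 0 < n → (X ^ n - 1 : ℤ[X]).Monic := fun n hn => monic_X_pow_sub_C 1 hn.ne'
  have hd : ∀ n, (X ^ n - 1 : ℤ[X]).natDegree = n := fun n => natDegree_X_pow_sub_C (r := 1)
  have h1 : (X - 1 : ℤ[X]).natDegree = 1 := natDegree_X_sub_C 1
  have h2 : (X - 1 : ℤ[X]).Monic := monic_X_sub_C 1
  have hPQ := Nat.mul_pos hP hQ
  have hQR := Nat.mul_pos hQ hR
  have hRP := Nat.mul_pos hR hP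
  rw [Qpoly, natDegree_divByMonic _ (monic_Qpoly_denominator hP hQ hR),
    (((h _ (Nat.mul_pos hPQ hR)).mul (h _ hP)).mul (h _ hQ)).natDegree_mul (h _ hR),
    ((h _ (Nat.mul_pos hPQ hR)).mul (h _ hP)).natDegree_mul (h _ hQ),
    (h _ (Nat.mul_pos hPQ hR)).natDegree_mul (h _ hP),
    (((h _ hPQ).mul (h _ hQR)).mul (h _ hRP)).natDegree_mul h2,
    ((h _ hPQ).mul (h _ hQR)).natDegree_mul (h _ hRP),
    (h _ hPQ).natDegree_mul (h _ hQR)]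
  simp only [hd, h1]
  obtain ⟨a, rfl⟩ := Nat.exists_eq_add_of_lt hP
  obtain ⟨b, rfl⟩ := Nat.exists_eq_add_of_lt hQ
  obtain ⟨c, rfl⟩ := Nat.exists_eq_add_of_lt hR
  simp only [zero_add, Nat.add_sub_cancel]
  rw [Nat.sub_eq_iff_eq_add]
  · ring
  · ring_nf; omega

theorem Qpoly_mul_eq {R : ℕ} (hP : P = 2 * l + 1) (hQ : Q = k * P + 2) (hR0 : 0 < R)
    (hR : 2 * R ≡ 1 [MOD P * Q]) :
    Qpoly P Q R * (1 - X ^ (P * Q)) = binarySum P Q l k (fun m => ((X : ℤ[X]) ^ R) ^ m) *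
      ((∑ i ∈ Finset.range P, X ^ i) * (1 - X ^ Q)) := by
  obtain ⟨Z, hZ⟩ := dvd_binarySum_mul hP hQ hR
  have h1 := binarySum_pow_mul hP hQ ((X : ℤ[X]) ^ R)
  have h2 := geom_sum_mul (X : ℤ[X]) P
  simp only [← pow_mul X R P, ← pow_mul X R Q, ← pow_mul X R (P * Q)] at h1
  have hQp : Qpoly P Q R = -Z := by
    rw [Qpoly, show (X ^ (P * Q * R) - 1) * (X ^ P - 1) * (X ^ Q - 1) * (X ^ R - 1) =
      ((X ^ (P * Q) - 1) * (X ^ (Q * R) - 1) * (X ^ (R * P) - 1) * (X - 1)) * -Z by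
        rw [mul_comm (P * Q) R, mul_comm Q R, ← h2]
        linear_combination (-(∑ i ∈ Finset.range P, X ^ i) * (X - 1) * (X ^ Q - 1)) * h1 +
          (-(X ^ (R * Q) - 1) * (X ^ (R * P) - 1) * (X - 1)) * hZ]
    exact mul_divByMonic_cancel_left _
      (monic_Qpoly_denominator (by omega) (by omega) hR0)
  rw [hQp, hZ]
  ring

/-- The natural numbers of the form `N - 2 * j` with `0 ≤ j < P`. -/
def stepWindow (P : ℕ) (N : ℤ) : Set ℕ :=
  {m | ∃ j : ℕ, j < P ∧ (m : ℤ) + 2 * j = N}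

theorem mk_residue_mul (hP : 2 ≤ P) (hPQ : P ≤ Q) :
    (PowerSeries.mk fun n : ℕ => ((if (n : ℤ) % (P * Q : ℕ) < P then 1 else 0) -
      if ((n : ℤ) - Q) % (P * Q : ℕ) < P then 1 else 0 : ℤ)) * (1 - PowerSeries.X ^ (P * Q)) =
      (∑ i ∈ Finset.range P, PowerSeries.X ^ i) * (1 - PowerSeries.X ^ Q) := by
  have hM : 2 * Q ≤ P * Q := Nat.mul_le_mul_right Q hP
  ext n
  have hsum : ∀ d, PowerSeries.coeff d (∑ i ∈ Finset.range P, PowerSeries.X ^ i : PowerSeries ℤ) =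
      if d < P then 1 else 0 := fun d => by
    simp [map_sum, PowerSeries.coeff_X_pow]
  simp only [mul_sub, mul_one, map_sub, PowerSeries.coeff_mul_X_pow', PowerSeries.coeff_mk, hsum]
  generalize P * Q = M at *
  by_cases hn : M ≤ n
  · rw [if_pos hn, if_pos (show Q ≤ n by omega), if_neg (show ¬ n < P by omega),
      if_neg (show ¬ n - Q < P by omega)]
    have h1 : ((n - M : ℕ) : ℤ) % M = n % M := by
      rw [Nat.cast_sub hn, Int.sub_emod_right]
    have h2 : (((n - M : ℕ) : ℤ) - Q) % M = (n - Q) % M := by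
      rw [Nat.cast_sub hn, sub_right_comm, Int.sub_emod_right]
    rw [h1, h2]; simp
  · have h1 : (n : ℤ) % M = n := Int.emod_eq_of_lt (by omega) (by omega)
    rw [if_neg hn, sub_zero, h1]
    congr 1
    · exact if_congr Nat.cast_lt rfl rfl
    by_cases hQn : Q ≤ n
    · rw [if_pos hQn, Int.emod_eq_of_lt (by omega) (by omega)]
      exact if_congr (by omega) rfl rfl
    · rw [if_neg hQn, ← Int.add_emod_right, Int.emod_eq_of_lt (by omega) (by omega)]
      exact if_neg (by omega)

theorem Qpoly_coeff_eq {R : ℕ} (hP : P = 2 * l + 1) (hQ : Q = k * P + 2) (hl : 0 < l) (hk : 0 < k)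
    (hR0 : 0 < R) (hR : 2 * R ≡ 1 [MOD P * Q]) (n : ℕ) :
    (Qpoly P Q R).coeff n = binarySum P Q l k (fun m => if R * m ≤ n then
      ((if ((n - R * m : ℕ) : ℤ) % (P * Q : ℕ) < P then 1 else 0) -
        if (((n - R * m : ℕ) : ℤ) - Q) % (P * Q : ℕ) < P then 1 else 0 : ℤ) else 0) := by
  have hPQ : P ≤ Q := by
    have := Nat.le_mul_of_pos_left P hk
    omega
  have hX : Polynomial.coeToPowerSeries.ringHom (X : ℤ[X]) = PowerSeries.X := Polynomial.coe_X
  have h1 := congrArg (Polynomial.toPowerSeries) (Qpoly_mul_eq hP hQ hR0 hR)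
  rw [Polynomial.coe_mul, Polynomial.coe_mul,
    show ((((∑ i ∈ Finset.range P, X ^ i) * (1 - X ^ Q) : ℤ[X])) : PowerSeries ℤ) =
      (∑ i ∈ Finset.range P, PowerSeries.X ^ i) * (1 - PowerSeries.X ^ Q) by
      simp [← Polynomial.coeToPowerSeries.ringHom_apply, map_sum, hX],
    ← mk_residue_mul (by omega) hPQ, ← mul_assoc,
    show ((1 - X ^ (P * Q) : ℤ[X]) : PowerSeries ℤ) = 1 - PowerSeries.X ^ (P * Q) by
      simp [← Polynomial.coeToPowerSeries.ringHom_apply, hX]] at h1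
  have hne : (1 - PowerSeries.X ^ (P * Q) : PowerSeries ℤ) ≠ 0 := fun h => by
    have h2 := congrArg (PowerSeries.coeff 0) h
    have h3 : 0 < P * Q := Nat.mul_pos (by omega) (by omega)
    rw [map_sub, PowerSeries.coeff_X_pow, if_neg h3.ne] at h2
    simp at h2
  have h2 := congrArg (PowerSeries.coeff n) (mul_right_cancel₀ hne h1)
  rw [Polynomial.coeff_coe, ← Polynomial.coeToPowerSeries.ringHom_apply, map_binarySum,
    binarySum_mul, map_binarySum] at h2
  rw [h2]
  congr 1
  funext m
  rw [Polynomial.coeToPowerSeries.ringHom_apply, ← pow_mul, Polynomial.coe_pow, Polynomial.coe_X,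
    PowerSeries.coeff_X_pow_mul']
  simp only [PowerSeries.coeff_mk]

theorem emod_lt_iff_mem_stepWindow {R : ℕ} (hPQ : P ≤ Q) (hP : 3 ≤ P)
    (hR : 2 * R ≡ 1 [MOD P * Q]) (s : ℤ) {m : ℕ} (hm : m + P + Q ≤ P * Q + 1) :
    (s - R * m) % (P * Q : ℕ) < P ↔ m ∈ stepWindow P ((2 * s) % (P * Q : ℕ)) := by
  have hM : 3 * Q ≤ P * Q := Nat.mul_le_mul_right Q hP
  generalize P * Q = M at *
  have hM0 : (0 : ℤ) < M := by omega
  have hR' : (M : ℤ) ∣ 2 * R - 1 := by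
    have := (Nat.modEq_iff_dvd.1 hR.symm); push_cast at this; exact this
  have hodd : IsCoprime (M : ℤ) 2 := by
    obtain ⟨c, hc⟩ := hR'
    exact ⟨-c, R, by linarith⟩
  have hN0 := Int.emod_nonneg (2 * s) hM0.ne'
  have hN1 := Int.emod_lt_of_pos (2 * s) hM0
  have hNd : (M : ℤ) ∣ 2 * s - (2 * s) % M := Int.dvd_self_sub_emod
  generalize (2 * s) % (M : ℤ) = N at *
  constructor
  · intro h
    have h0 := Int.emod_nonneg (s - R * m) hM0.ne'
    have hd : (M : ℤ) ∣ (s - R * m) - (s - R * m) % M := Int.dvd_self_sub_emod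
    generalize (s - R * m) % (M : ℤ) = j at *
    refine ⟨j.toNat, by omega, ?_⟩
    rw [Int.toNat_of_nonneg h0]
    have : (M : ℤ) ∣ m + 2 * j - N := by
      have := ((hd.mul_left 2).neg_right.add hNd).sub (hR'.mul_right m)
      convert! this using 1
      ring
    have := Int.eq_zero_of_abs_lt_dvd this (abs_lt.2 ⟨by omega, by omega⟩)
    omega
  · rintro ⟨j, hj, hjN⟩
    have : (M : ℤ) ∣ 2 * (s - R * m - j) := by
      have := hNd.sub (hR'.mul_right m)
      convert! this using 1
      rw [← hjN]; ring
    have := hodd.dvd_of_dvd_mul_left this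
    have h2 : (s - R * m) % (M : ℤ) = j % M := ((Int.modEq_iff_dvd).2 this).symm
    rw [h2, Int.emod_eq_of_lt (by omega) (by omega)]
    omega

section boxes

variable {a b c : ℕ} {W : Set ℕ}

theorem box_sum_nonneg :
    0 ≤ ∑ x ∈ Finset.range a, ∑ y ∈ Finset.range b,
      W.indicator (1 : ℕ → ℤ) (P * x + Q * y + c) :=
  Finset.sum_nonneg fun _ _ => Finset.sum_nonneg fun _ _ =>
    Set.indicator_nonneg (fun _ _ => zero_le_one) _

theorem box_sum_eq_zero (h : ∀ x < a, ∀ y < b, P * x + Q * y + c ∉ W) :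
    ∑ x ∈ Finset.range a, ∑ y ∈ Finset.range b,
      W.indicator (1 : ℕ → ℤ) (P * x + Q * y + c) = 0 :=
  Finset.sum_eq_zero fun x hx => Finset.sum_eq_zero fun y hy => Set.indicator_of_notMem
    (h x (Finset.mem_range.1 hx) y (Finset.mem_range.1 hy)) _

theorem le_box_sum (h : ∀ y < b, ∃ x < a, P * x + Q * y + c ∈ W) :
    (b : ℤ) ≤ ∑ x ∈ Finset.range a, ∑ y ∈ Finset.range b,
      W.indicator (1 : ℕ → ℤ) (P * x + Q * y + c) := by
  rw [Finset.sum_comm]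
  calc (b : ℤ) = ∑ y ∈ Finset.range b, 1 := by simp
    _ ≤ _ := Finset.sum_le_sum fun y hy => by
      obtain ⟨x, hx, hW⟩ := h y (Finset.mem_range.1 hy)
      have := Finset.single_le_sum (s := Finset.range a)
        (f := fun x => W.indicator (1 : ℕ → ℤ) (P * x + Q * y + c))
        (fun _ _ => Set.indicator_nonneg (fun _ _ => zero_le_one) _) (Finset.mem_range.2 hx)
      simpa [hW] using this

theorem box_sum_le (hP : Odd P) {N : ℤ} (hW : W ⊆ stepWindow P N) (T : Finset ℕ)
    (h : ∀ x < a, ∀ y < b, P * x + Q * y + c ∈ W → y ∈ T) :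
    ∑ x ∈ Finset.range a, ∑ y ∈ Finset.range b,
      W.indicator (1 : ℕ → ℤ) (P * x + Q * y + c) ≤ T.card := by
  have huniq : ∀ x x' y, P * x + Q * y + c ∈ W → P * x' + Q * y + c ∈ W → x = x' := by
    intro x x' y h1 h2
    obtain ⟨j, hj, hjN⟩ := hW h1
    obtain ⟨i, hi, hiN⟩ := hW h2
    have hco : IsCoprime (P : ℤ) 2 := by
      exact_mod_cast Nat.isCoprime_iff_coprime.2 (Nat.coprime_two_right.2 hP)
    have hd : (P : ℤ) ∣ 2 * (i - j) := ⟨x - x', by push_cast at hjN hiN; linarith⟩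
    have h0 := Int.eq_zero_of_abs_lt_dvd (hco.dvd_of_dvd_mul_left hd)
      (abs_lt.2 ⟨by omega, by omega⟩)
    have hij : i = j := by omega
    subst hij
    have : P * x = P * x' := by zify; push_cast at hjN hiN; linarith
    exact Nat.eq_of_mul_eq_mul_left hP.pos this
  rw [Finset.sum_comm]
  calc _ ≤ ∑ y ∈ Finset.range b, (if y ∈ T then 1 else 0 : ℤ) :=
        Finset.sum_le_sum fun y hy => ?_
    _ ≤ T.card := by
        rw [Finset.sum_boole, Nat.cast_le]
        exact Finset.card_le_card fun y hy => (Finset.mem_filter.1 hy).2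
  by_cases hx : ∃ x ∈ Finset.range a, P * x + Q * y + c ∈ W
  · obtain ⟨x, hxa, hxW⟩ := hx
    rw [Finset.sum_eq_single_of_mem x hxa fun x' _ hne =>
        Set.indicator_of_notMem (fun h' => hne (huniq _ _ _ h' hxW)) _,
      Set.indicator_of_mem hxW,
      if_pos (h x (Finset.mem_range.1 hxa) y (Finset.mem_range.1 hy) hxW)]
    rfl
  · push Not at hx
    rw [Finset.sum_eq_zero fun x hxa => Set.indicator_of_notMem (hx x hxa) _]
    split_ifs <;> norm_num

end boxes

theorem binarySum_indicator_le (hP : P = 2 * l + 1) {N : ℤ} {W : Set ℕ}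
    (hW : W ⊆ stepWindow P N) : binarySum P Q l k (W.indicator (1 : ℕ → ℤ)) ≤ l + 1 := by
  have h1 := box_sum_le (P := P) (Q := Q) (a := k * l + 1) (b := l + 1) (c := 0) ⟨l, hP⟩ hW
    (Finset.range (l + 1)) fun x _ y hy _ => Finset.mem_range.2 hy
  have h2 := box_sum_nonneg (P := P) (Q := Q) (a := k * (l + 1) + 1) (b := l) (c := 1) (W := W)
  simp only [add_zero, Finset.card_range, Nat.cast_add, Nat.cast_one] at h1
  rw [binarySum]
  linarith

theorem le_binarySum_indicator (hP : P = 2 * l + 1) {N : ℤ} {W : Set ℕ}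
    (hW : W ⊆ stepWindow P N) : -(l : ℤ) ≤ binarySum P Q l k (W.indicator (1 : ℕ → ℤ)) := by
  have h1 := box_sum_nonneg (P := P) (Q := Q) (a := k * l + 1) (b := l + 1) (c := 0) (W := W)
  have h2 := box_sum_le (P := P) (Q := Q) (a := k * (l + 1) + 1) (b := l) (c := 1) ⟨l, hP⟩ hW
    (Finset.range l) fun x _ y hy _ => Finset.mem_range.2 hy
  simp only [add_zero, Finset.card_range] at h1 h2
  rw [binarySum]
  linarith

theorem binarySum_indicator_le_of_outer (hP : P = 2 * l + 1) {N : ℤ} {W : Set ℕ}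
    (hW : W ⊆ stepWindow P N) (hN : N < Q * l ∨ P * (k * l) + 2 * (P - 1) < N) :
    binarySum P Q l k (W.indicator (1 : ℕ → ℤ)) ≤ l := by
  obtain ⟨z, hz, hzW⟩ : ∃ z ≤ l, ∀ x < k * l + 1, P * x + Q * z + 0 ∉ W := by
    obtain hN | hN := hN
    · refine ⟨l, le_rfl, fun x _ h => ?_⟩
      obtain ⟨j, hj, hjN⟩ := hW h
      push_cast at hjN
      have : (0 : ℤ) ≤ P * x := by positivity
      linarith
    · refine ⟨0, Nat.zero_le l, fun x hx h => ?_⟩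
      obtain ⟨j, hj, hjN⟩ := hW h
      have : P * x ≤ P * (k * l) := Nat.mul_le_mul_left P (Nat.lt_succ_iff.1 hx)
      zify at this
      push_cast at hjN
      rw [mul_zero] at hjN
      have : (j : ℤ) ≤ P - 1 := by omega
      linarith
  have h1 := box_sum_le (P := P) (Q := Q) (a := k * l + 1) (b := l + 1) (c := 0) ⟨l, hP⟩ hW
    ((Finset.range (l + 1)).erase z) fun x hx y hy h => Finset.mem_erase.2
      ⟨by rintro rfl; exact hzW x hx h, Finset.mem_range.2 hy⟩
  have h2 := box_sum_nonneg (P := P) (Q := Q) (a := k * (l + 1) + 1) (b := l) (c := 1) (W := W)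
  rw [Finset.card_erase_of_mem (Finset.mem_range.2 (by omega)), Finset.card_range] at h1
  simp only [add_zero, Nat.add_sub_cancel] at h1
  rw [binarySum]
  linarith

/-- Upper end of the window `stepWindow P (Q * l)`, covered by the positive exponents. -/
theorem binarySum_indicator_upper (hP : P = 2 * l + 1) (hQ : Q = k * P + 2) {W : Set ℕ}
    (hW : ∀ m, m ∈ W ↔ ∃ j ≤ l, m + 2 * j = Q * l) :
    binarySum P Q l k (W.indicator (1 : ℕ → ℤ)) = l + 1 := by
  refine le_antisymm (binarySum_indicator_le hP (N := Q * l) fun m hm => ?_) ?_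
  · obtain ⟨j, hj, hjm⟩ := (hW m).1 hm
    exact ⟨j, by omega, by exact_mod_cast hjm⟩
  have h1 := le_box_sum (P := P) (Q := Q) (a := k * l + 1) (b := l + 1) (c := 0) (W := W)
    fun y hy => by
      obtain ⟨j, rfl⟩ := Nat.exists_eq_add_of_le (Nat.lt_succ_iff.1 hy)
      refine ⟨k * j, Nat.lt_succ_of_le (Nat.mul_le_mul_left k (by omega)),
        (hW _).2 ⟨j, by omega, ?_⟩⟩
      subst hQ
      ring
  have h2 := box_sum_eq_zero (P := P) (Q := Q) (a := k * (l + 1) + 1) (b := l) (c := 1) (W := W)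
    fun x hx y hy h => by
      obtain ⟨j, hj, hjm⟩ := (hW _).1 h
      have hd : (P : ℤ) ∣ 2 * (y + j - l) + 1 := ⟨k * l - x - k * y, by
        zify at hjm hQ; rw [hQ] at hjm; linarith⟩
      have hd' : (P : ℤ) ∣ 2 * (y + j + 1) := by
        have := hd.add (dvd_refl (P : ℤ))
        convert! this using 1
        rw [hP]; push_cast; ring
      have hco : IsCoprime (P : ℤ) 2 := by
        exact_mod_cast Nat.isCoprime_iff_coprime.2 (Nat.coprime_two_right.2 ⟨l, hP⟩)
      have := Int.eq_zero_of_abs_lt_dvd (hco.dvd_of_dvd_mul_left hd')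
        (abs_lt.2 ⟨by omega, by omega⟩)
      omega
  simp only [add_zero, Nat.cast_add, Nat.cast_one] at h1
  rw [binarySum, h2]
  linarith

/-- Lower end of the window `stepWindow P (Q * l)`, covered by the negative exponents. -/
theorem binarySum_indicator_lower (hP : P = 2 * l + 1) (hQ : Q = k * P + 2) (hk : 0 < k)
    {W : Set ℕ} (hW : ∀ m, m ∈ W ↔ ∃ j, l < j ∧ j < P ∧ m + 2 * j = Q * l) :
    binarySum P Q l k (W.indicator (1 : ℕ → ℤ)) = -l := by
  refine le_antisymm ?_ (le_binarySum_indicator hP (N := Q * l) fun m hm => ?_)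
  swap
  · obtain ⟨j, _, hj, hjm⟩ := (hW m).1 hm
    exact ⟨j, by omega, by exact_mod_cast hjm⟩
  have h1 := le_box_sum (P := P) (Q := Q) (a := k * (l + 1) + 1) (b := l) (c := 1) (W := W)
    fun y hy => by
      obtain ⟨i, hi⟩ := Nat.exists_eq_add_of_lt hy
      obtain ⟨e, rfl⟩ := Nat.exists_eq_add_of_lt hk
      refine ⟨e + (0 + e + 1) * i, ?_, (hW _).2 ⟨l + 1 + i, by omega, by omega, ?_⟩⟩
      · have : e + (0 + e + 1) * i + 1 + (0 + e + 1) * (y + 1) = (0 + e + 1) * (l + 1) := by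
          subst hi; ring
        omega
      · subst hQ hP hi
        ring
  have h2 := box_sum_eq_zero (P := P) (Q := Q) (a := k * l + 1) (b := l + 1) (c := 0) (W := W)
    fun x hx y hy h => by
      obtain ⟨j, hj, hjP, hjm⟩ := (hW _).1 h
      have hd : (P : ℤ) ∣ 2 * (y + j - l) := ⟨k * l - x - k * y, by
        zify at hjm hQ; rw [hQ] at hjm; linarith⟩
      have hco : IsCoprime (P : ℤ) 2 := by
        exact_mod_cast Nat.isCoprime_iff_coprime.2 (Nat.coprime_two_right.2 ⟨l, hP⟩)
      have := Int.eq_zero_of_abs_lt_dvd (hco.dvd_of_dvd_mul_left hd)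
        (abs_lt.2 ⟨by omega, by omega⟩)
      omega
  simp only [add_zero] at h2
  rw [binarySum, h2]
  linarith

theorem binarySum_indicator_inter_add_diff (W B : Set ℕ) :
    binarySum P Q l k ((W ∩ B).indicator (1 : ℕ → ℤ)) +
      binarySum P Q l k ((W \ B).indicator (1 : ℕ → ℤ)) =
      binarySum P Q l k (W.indicator (1 : ℕ → ℤ)) := by
  rw [← binarySum_add]
  congr 1
  ext m
  by_cases hW : m ∈ W <;> by_cases hB : m ∈ B <;> simp [hW, hB]

theorem Qpoly_coeff_eq_sub {R : ℕ} (hP : P = 2 * l + 1) (hQ : Q = k * P + 2) (hl : 0 < l)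
    (hk : 0 < k) (hR0 : 0 < R) (hR : 2 * R ≡ 1 [MOD P * Q]) (n : ℕ) :
    (Qpoly P Q R).coeff n =
      binarySum P Q l k
        ((stepWindow P ((2 * n) % (P * Q : ℕ)) ∩ {m | R * m ≤ n}).indicator (1 : ℕ → ℤ)) -
      binarySum P Q l k
        ((stepWindow P ((2 * (n - Q)) % (P * Q : ℕ)) ∩ {m | R * m ≤ n}).indicator
          (1 : ℕ → ℤ)) := by
  have hPQ : P ≤ Q := by
    have := Nat.le_mul_of_pos_left P hk
    omega
  rw [Qpoly_coeff_eq hP hQ hl hk hR0 hR, ← binarySum_sub]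
  refine binarySum_congr hP hQ fun m hm => ?_
  by_cases hB : R * m ≤ n
  · have h1 := emod_lt_iff_mem_stepWindow hPQ (by omega) hR n hm
    have h2 := emod_lt_iff_mem_stepWindow hPQ (by omega) hR (n - Q) hm
    classical
    simp only [Pi.sub_apply, Set.indicator_apply, Set.mem_inter_iff, Set.mem_ofPred_eq,
      hB, and_true, Pi.one_apply]
    rw [Nat.cast_sub hB, Nat.cast_mul, sub_right_comm (n : ℤ)]
    exact congrArg₂ (· - ·) (if_congr h1 rfl rfl) (if_congr h2 rfl rfl)
  · simp [hB]

theorem binarySum_indicator_stepWindow_eq {R : ℕ} (hP : P = 2 * l + 1) (hQ : Q = k * P + 2)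
    (hl : 0 < l) (hk : 0 < k) (hR0 : 0 < R) (hR : 2 * R ≡ 1 [MOD P * Q]) (n : ℕ) :
    binarySum P Q l k ((stepWindow P ((2 * n) % (P * Q : ℕ))).indicator (1 : ℕ → ℤ)) =
      binarySum P Q l k ((stepWindow P ((2 * (n - Q)) % (P * Q : ℕ))).indicator
        (1 : ℕ → ℤ)) := by
  have hP0 : 0 < P := by omega
  have hQ0 : 0 < Q := by omega
  have hM0 : (0 : ℤ) < (P * Q : ℕ) := by exact_mod_cast Nat.mul_pos hP0 hQ0
  have hdeg : (Qpoly P Q R).natDegree < n + P * Q * R := by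
    rw [natDegree_Qpoly hP0 hQ0 hR0]
    refine Nat.lt_add_left _ (Nat.mul_lt_mul_of_le_of_lt ?_ (by omega) (by positivity))
    exact Nat.mul_le_mul (Nat.sub_le ..) (Nat.sub_le ..)
  have h1 := Qpoly_coeff_eq_sub hP hQ hl hk hR0 hR (n + P * Q * R)
  have hB : ∀ s : ℤ, stepWindow P (s % (P * Q : ℕ)) ∩ {m | R * m ≤ n + P * Q * R} =
      stepWindow P (s % (P * Q : ℕ)) := fun s => Set.inter_eq_left.2 fun m hm => by
    obtain ⟨j, hj, hjN⟩ := hm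
    have := Int.emod_lt_of_pos s hM0
    rw [Set.mem_ofPred_eq, mul_comm]
    exact (Nat.mul_le_mul_right R (by omega)).trans (Nat.le_add_left ..)
  have e1 : (2 * ((n + P * Q * R : ℕ) : ℤ)) % (P * Q : ℕ) = (2 * n) % (P * Q : ℕ) :=
    Int.modEq_iff_dvd.2 ⟨-(2 * R), by push_cast; ring⟩
  have e2 : (2 * (((n + P * Q * R : ℕ) : ℤ) - Q)) % (P * Q : ℕ) =
      (2 * (n - Q)) % (P * Q : ℕ) :=
    Int.modEq_iff_dvd.2 ⟨-(2 * R), by push_cast; ring⟩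
  rw [coeff_eq_zero_of_natDegree_lt hdeg, hB, hB, e1, e2] at h1
  linarith

theorem lt_of_mem_stepWindow {M N : ℤ} (h : M + 2 * P ≤ N + 1) {m : ℕ} (hm : m ∈ stepWindow P N) :
    M < m := by
  obtain ⟨j, hj, hjN⟩ := hm
  omega

theorem le_of_mem_stepWindow {N : ℤ} {m : ℕ} (hm : m ∈ stepWindow P N) : m ≤ N := by
  obtain ⟨j, hj, hjN⟩ := hm
  omega

theorem exists_binarySum_indicator_eq_sub {M N : ℤ} (h : M + 2 * P ≤ N + 1)
    (heq : binarySum P Q l k ((stepWindow P M).indicator (1 : ℕ → ℤ)) =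
      binarySum P Q l k ((stepWindow P N).indicator (1 : ℕ → ℤ))) (R n : ℕ) :
    ∃ W : Set ℕ, (W ⊆ stepWindow P M ∨ W ⊆ stepWindow P N) ∧
      binarySum P Q l k ((stepWindow P M ∩ {m | R * m ≤ n}).indicator (1 : ℕ → ℤ)) -
        binarySum P Q l k ((stepWindow P N ∩ {m | R * m ≤ n}).indicator (1 : ℕ → ℤ)) =
        binarySum P Q l k (W.indicator (1 : ℕ → ℤ)) := by
  by_cases hM : R * M ≤ n
  · refine ⟨stepWindow P N \ {m | R * m ≤ n}, Or.inr Set.sdiff_subset, ?_⟩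
    rw [sub_eq_iff_eq_add', binarySum_indicator_inter_add_diff _ {m | R * m ≤ n}, ← heq,
      Set.inter_eq_left.2]
    intro m hm
    rw [Set.mem_ofPred_eq]
    have := mul_le_mul_of_nonneg_left (le_of_mem_stepWindow hm) (Int.natCast_nonneg R)
    exact_mod_cast this.trans hM
  · refine ⟨stepWindow P M ∩ {m | R * m ≤ n}, Or.inl Set.inter_subset_left, ?_⟩
    rw [Set.eq_empty_of_forall_notMem (s := stepWindow P N ∩ _), Set.indicator_empty',
      sub_eq_self]
    · simp [binarySum]
    rintro m ⟨hm, hmn⟩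
    rw [Set.mem_ofPred_eq] at hmn
    zify at hmn
    exact hM ((mul_le_mul_of_nonneg_left (lt_of_mem_stepWindow h hm).le
      (Int.natCast_nonneg R)).trans hmn)

theorem Int.emod_eq_of_dvd_sub {a b m : ℤ} (hb : 0 ≤ b) (hbm : b < m) (h : m ∣ a - b) :
    a % m = b := by
  rw [← Int.emod_eq_of_lt hb hbm]
  exact (Int.modEq_iff_dvd.2 h).symm

/-- A coefficient is, up to sign, a sum over part of a single window. -/
theorem exists_Qpoly_coeff_eq {R : ℕ} (hP : P = 2 * l + 1) (hQ : Q = k * P + 2) (hl : 0 < l)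
    (hk : 0 < k) (hR0 : 0 < R) (hR : 2 * R ≡ 1 [MOD P * Q]) (n : ℕ) :
    ∃ (N : ℤ) (W : Set ℕ), W ⊆ stepWindow P N ∧
      (((N < (P - 2) * Q ∨ 2 * Q ≤ N) ∧
        (Qpoly P Q R).coeff n = -binarySum P Q l k (W.indicator (1 : ℕ → ℤ))) ∨
      ((N < 2 * Q ∨ (P - 2) * Q ≤ N) ∧
        (Qpoly P Q R).coeff n = binarySum P Q l k (W.indicator (1 : ℕ → ℤ)))) := by
  have hPQ : P ≤ Q := by
    have := Nat.le_mul_of_pos_left P hk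
    omega
  have hMQ : 3 * Q ≤ P * Q := Nat.mul_le_mul_right Q (by omega)
  have hM0 : (0 : ℤ) < (P * Q : ℕ) := by exact_mod_cast Nat.mul_pos (by omega) (by omega)
  have hc := Qpoly_coeff_eq_sub hP hQ hl hk hR0 hR n
  have hF := binarySum_indicator_stepWindow_eq hP hQ hl hk hR0 hR n
  have hN0 := Int.emod_nonneg (2 * (n : ℤ)) hM0.ne'
  have hN1 := Int.emod_lt_of_pos (2 * (n : ℤ)) hM0
  have hNd : ((P * Q : ℕ) : ℤ) ∣ 2 * n - (2 * n) % (P * Q : ℕ) := Int.dvd_self_sub_emod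
  have hmul : ((P : ℤ) - 2) * Q = (P * Q : ℕ) - 2 * Q := by push_cast; ring
  generalize (2 * (n : ℤ)) % (P * Q : ℕ) = N at *
  rw [hmul]
  by_cases hN : 2 * Q ≤ N
  · have hN' : (2 * ((n : ℤ) - Q)) % (P * Q : ℕ) = N - 2 * Q :=
      Int.emod_eq_of_dvd_sub (by omega) (by omega) (by convert! hNd using 1; ring)
    rw [hN'] at hc hF
    obtain ⟨W, hW, hs⟩ := exists_binarySum_indicator_eq_sub (M := N - 2 * Q) (N := N)
      (by omega) hF.symm R n
    have hcW : (Qpoly P Q R).coeff n = -binarySum P Q l k (W.indicator (1 : ℕ → ℤ)) := by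
      rw [hc, ← hs]; ring
    obtain hW | hW := hW
    · exact ⟨_, W, hW, Or.inl ⟨Or.inl (by omega), hcW⟩⟩
    · exact ⟨_, W, hW, Or.inl ⟨Or.inr hN, hcW⟩⟩
  · have hN' : (2 * ((n : ℤ) - Q)) % (P * Q : ℕ) = N + ((P * Q : ℕ) - 2 * Q) :=
      Int.emod_eq_of_dvd_sub (by omega) (by omega)
        (by convert! hNd.sub (dvd_refl _) using 1; ring)
    rw [hN'] at hc hF
    have hsep : (2 : ℤ) * P ≤ (P * Q : ℕ) - 2 * Q + 1 := by
      have : P + 2 ≤ Q := hQ ▸ Nat.add_le_add_right (Nat.le_mul_of_pos_left P hk) 2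
      obtain rfl | hl : l = 1 ∨ 2 ≤ l := by omega
      · omega
      · have : 5 * Q ≤ P * Q := Nat.mul_le_mul_right Q (by omega)
        omega
    obtain ⟨W, hW, hs⟩ := exists_binarySum_indicator_eq_sub (by linarith) hF R n
    rw [← hc] at hs
    obtain hW | hW := hW
    · exact ⟨_, W, hW, Or.inr ⟨Or.inl (by omega), hs⟩⟩
    · exact ⟨_, W, hW, Or.inr ⟨Or.inr (by omega), hs⟩⟩

theorem Qpoly_coeff_mem_Icc {R : ℕ} (hP : P = 2 * l + 1) (hQ : Q = k * P + 2) (hl : 2 ≤ l)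
    (hk : 0 < k) (hR0 : 0 < R) (hR : 2 * R ≡ 1 [MOD P * Q]) (n : ℕ) :
    (Qpoly P Q R).coeff n ∈ Set.Icc (-(l + 1) : ℤ) l := by
  obtain ⟨N, W, hW, ⟨-, h⟩ | ⟨hN, h⟩⟩ := exists_Qpoly_coeff_eq hP hQ (by omega) hk hR0 hR n
  · have h1 := binarySum_indicator_le (Q := Q) (k := k) hP hW
    have h2 := le_binarySum_indicator (Q := Q) (k := k) hP hW
    constructor <;> linarith
  · have h2 := le_binarySum_indicator (Q := Q) (k := k) hP hW
    have h1 := binarySum_indicator_le_of_outer (Q := Q) (k := k) hP hW <| hN.imp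
      (fun h => h.trans_le (by rw [mul_comm]; gcongr; exact_mod_cast hl)) fun h => by
        refine lt_of_lt_of_le ?_ h
        have : (P : ℤ) + 2 ≤ Q := by
          exact_mod_cast hQ ▸ Nat.add_le_add_right (Nat.le_mul_of_pos_left P hk) 2
        zify at hP hQ hl
        have hPk : (P : ℤ) * (k * l) = (Q - 2) * l := by rw [hQ]; ring
        rw [hPk]
        rw [hP] at this ⊢
        nlinarith
    constructor <;> linarith

theorem Qpoly_three_coeff_mem_Icc {R : ℕ} (hQ : Q = k * 3 + 2) (hk : 0 < k) (hR0 : 0 < R)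
    (hR : 2 * R ≡ 1 [MOD 3 * Q]) (n : ℕ) : (Qpoly 3 Q R).coeff n ∈ Set.Icc (-1 : ℤ) 2 := by
  have hP : 3 = 2 * 1 + 1 := rfl
  obtain ⟨N, W, hW, ⟨hN, h⟩ | ⟨-, h⟩⟩ := exists_Qpoly_coeff_eq hP hQ one_pos hk hR0 hR n
  · have h2 := le_binarySum_indicator (Q := Q) (k := k) hP hW
    have h1 := binarySum_indicator_le_of_outer (Q := Q) (k := k) hP hW <| hN.imp
      (fun h => by push_cast at h ⊢; linarith) fun h => by push_cast; omega
    push_cast at h1 h2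
    constructor <;> linarith
  · have h1 := binarySum_indicator_le (Q := Q) (k := k) hP hW
    have h2 := le_binarySum_indicator (Q := Q) (k := k) hP hW
    push_cast at h1 h2
    constructor <;> linarith

theorem exists_two_mul_modEq_of_le {M R : ℕ} (hM : 0 < M) (hMR : M ≤ R)
    (hR : 2 * R ≡ 1 [MOD M]) (T : ℕ) (c : ℤ) :
    ∃ n : ℕ, T * R ≤ n ∧ n < (T + 1) * R ∧ 2 * (n : ℤ) ≡ c [ZMOD M] := by
  have hM0 : (0 : ℤ) < M := by exact_mod_cast hM
  obtain ⟨s, hs⟩ := Int.eq_ofNat_of_zero_le (Int.emod_nonneg (R * c - T * R) hM0.ne')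
  have hsM := Int.emod_lt_of_pos (R * c - T * R) hM0
  refine ⟨T * R + s, Nat.le_add_right .., by rw [add_one_mul]; omega, ?_⟩
  have h1 : (s : ℤ) ≡ R * c - T * R [ZMOD M] := hs ▸ Int.mod_modEq _ _
  have h2 : 2 * (R : ℤ) ≡ 1 [ZMOD M] := by exact_mod_cast (Int.natCast_modEq_iff.2 hR)
  have h3 := ((h1.add_left (T * R)).mul_left 2).trans
    (show 2 * ((T : ℤ) * R + (R * c - T * R)) ≡ c [ZMOD M] by
      have := h2.mul_right c
      convert! this using 1 <;> ring)
  exact_mod_cast h3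

section cut

variable {R T n : ℕ} {N : ℤ}

theorem mul_le_iff_of_cut (h1 : T * R ≤ n) (h2 : n < (T + 1) * R) {m : ℕ} : R * m ≤ n ↔ m ≤ T := by
  rw [mul_comm]
  refine ⟨fun h => Nat.lt_succ_iff.1 (lt_of_mul_lt_mul_right (h.trans_lt h2) (Nat.zero_le R)),
    fun h => (Nat.mul_le_mul_right R h).trans h1⟩

theorem stepWindow_inter_cut_eq_self (h1 : T * R ≤ n) (h2 : n < (T + 1) * R) (hN : N ≤ T) :
    stepWindow P N ∩ {m | R * m ≤ n} = stepWindow P N :=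
  Set.inter_eq_left.2 fun m hm => (mul_le_iff_of_cut h1 h2).2 <| by
    have := le_of_mem_stepWindow hm
    omega

theorem stepWindow_inter_cut_eq_empty (h1 : T * R ≤ n) (h2 : n < (T + 1) * R)
    (hN : T + 2 * P ≤ N + 1) : stepWindow P N ∩ {m | R * m ≤ n} = ∅ :=
  Set.eq_empty_of_forall_notMem fun m ⟨hm, hmn⟩ => by
    have := lt_of_mem_stepWindow hN hm
    have := (mul_le_iff_of_cut h1 h2).1 hmn
    omega

theorem binarySum_stepWindow_inter_cut (hP : P = 2 * l + 1) (hQ : Q = k * P + 2) (hk : 0 < k)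
    (hT : T + 2 * l + 2 = Q * l) (h1 : T * R ≤ n) (h2 : n < (T + 1) * R) :
    binarySum P Q l k
      ((stepWindow P ((Q * l : ℕ) : ℤ) ∩ {m | R * m ≤ n}).indicator (1 : ℕ → ℤ)) = -l := by
  refine binarySum_indicator_lower hP hQ hk fun m => ?_
  rw [Set.mem_inter_iff, Set.mem_ofPred_eq, mul_le_iff_of_cut h1 h2]
  constructor
  · rintro ⟨⟨j, hj, hjN⟩, hm⟩
    exact ⟨j, by omega, hj, by exact_mod_cast hjN⟩
  · rintro ⟨j, hlj, hj, hjN⟩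
    exact ⟨⟨j, hj, by exact_mod_cast hjN⟩, by omega⟩

end cut

theorem binarySum_stepWindow (hP : P = 2 * l + 1) (hQ : Q = k * P + 2) (hk : 0 < k) :
    binarySum P Q l k ((stepWindow P ((Q * l : ℕ) : ℤ)).indicator (1 : ℕ → ℤ)) = 1 := by
  rw [← binarySum_indicator_inter_add_diff _ {m | m + 2 * l + 2 ≤ Q * l},
    binarySum_indicator_lower hP hQ hk, binarySum_indicator_upper hP hQ]
  · ring
  · intro m
    rw [Set.mem_sdiff, Set.mem_ofPred_eq]
    constructor
    · rintro ⟨⟨j, hj, hjN⟩, hm⟩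
      exact ⟨j, by omega, by exact_mod_cast hjN⟩
    · rintro ⟨j, hj, hjN⟩
      exact ⟨⟨j, by omega, by exact_mod_cast hjN⟩, by omega⟩
  · intro m
    rw [Set.mem_inter_iff, Set.mem_ofPred_eq]
    constructor
    · rintro ⟨⟨j, hj, hjN⟩, hm⟩
      exact ⟨j, by omega, hj, by exact_mod_cast hjN⟩
    · rintro ⟨j, hlj, hj, hjN⟩
      exact ⟨⟨j, hj, by exact_mod_cast hjN⟩, by omega⟩

theorem exists_Qpoly_coeff_eq_extremes {R : ℕ} (hP : P = 2 * l + 1) (hQ : Q = k * P + 2)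
    (hl : 2 ≤ l) (hk : 0 < k) (hPQR : P * Q ≤ R) (hR : 2 * R ≡ 1 [MOD P * Q]) :
    (∃ n, (Qpoly P Q R).coeff n = -(l + 1)) ∧ ∃ n, (Qpoly P Q R).coeff n = l := by
  have hPQ : P + 2 ≤ Q := hQ ▸ Nat.add_le_add_right (Nat.le_mul_of_pos_left P hk) 2
  have hM : 0 < P * Q := Nat.mul_pos (by omega) (by omega)
  have hPl : P * Q = 2 * (Q * l) + Q := by rw [hP]; ring
  have hQl : 2 * Q ≤ Q * l := by rw [mul_comm]; exact Nat.mul_le_mul_left Q hl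
  obtain ⟨T, hT⟩ := Nat.exists_eq_add_of_le' (show 2 * l + 2 ≤ Q * l by omega)
  have hT : T + 2 * l + 2 = Q * l := hT.symm
  have hfull := binarySum_stepWindow hP hQ hk
  constructor
  · obtain ⟨n, h1, h2, hn⟩ := exists_two_mul_modEq_of_le hM hPQR hR T (Q * l : ℕ)
    have hd := hn.symm.dvd
    have hN : (2 * (n : ℤ)) % (P * Q : ℕ) = (Q * l : ℕ) :=
      Int.emod_eq_of_dvd_sub (by omega) (by omega) hd
    have hN' : (2 * ((n : ℤ) - Q)) % (P * Q : ℕ) = (Q * l : ℕ) - 2 * Q :=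
      Int.emod_eq_of_dvd_sub (by omega) (by omega) (by convert! hd using 1; ring)
    have hc := Qpoly_coeff_eq_sub hP hQ (by omega) hk (by omega) hR n
    have hF := binarySum_indicator_stepWindow_eq hP hQ (by omega) hk (by omega) hR n
    rw [hN, hN'] at hc hF
    rw [binarySum_stepWindow_inter_cut hP hQ hk hT h1 h2,
      stepWindow_inter_cut_eq_self h1 h2 (by omega), ← hF, hfull] at hc
    exact ⟨n, by rw [hc]; ring⟩
  · obtain ⟨n, h1, h2, hn⟩ := exists_two_mul_modEq_of_le hM hPQR hR T ((Q * l : ℕ) + 2 * Q)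
    have hd := hn.symm.dvd
    have hN : (2 * (n : ℤ)) % (P * Q : ℕ) = (Q * l : ℕ) + 2 * Q :=
      Int.emod_eq_of_dvd_sub (by omega) (by omega) hd
    have hN' : (2 * ((n : ℤ) - Q)) % (P * Q : ℕ) = (Q * l : ℕ) :=
      Int.emod_eq_of_dvd_sub (by omega) (by omega) (by convert! hd using 1; ring)
    have hc := Qpoly_coeff_eq_sub hP hQ (by omega) hk (by omega) hR n
    rw [hN, hN', binarySum_stepWindow_inter_cut hP hQ hk hT h1 h2,
      stepWindow_inter_cut_eq_empty h1 h2 (by omega), Set.indicator_empty'] at hc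
    exact ⟨n, by rw [hc]; simp [binarySum]⟩

theorem exists_Qpoly_three_coeff_eq_extremes {R : ℕ} (hQ : Q = k * 3 + 2) (hk : 0 < k)
    (hPQR : 3 * Q ≤ R) (hR : 2 * R ≡ 1 [MOD 3 * Q]) :
    (∃ n, (Qpoly 3 Q R).coeff n = -1) ∧ ∃ n, (Qpoly 3 Q R).coeff n = 2 := by
  have hP : 3 = 2 * 1 + 1 := rfl
  obtain ⟨T, hT⟩ := Nat.exists_eq_add_of_le' (show 2 * 1 + 2 ≤ Q * 1 by omega)
  have hT : T + 2 * 1 + 2 = Q * 1 := hT.symm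
  have hfull := binarySum_stepWindow hP hQ hk
  constructor
  · obtain ⟨n, h1, h2, hn⟩ := exists_two_mul_modEq_of_le (by omega) hPQR hR T (Q * 1 : ℕ)
    have hd := hn.symm.dvd
    have hN : (2 * (n : ℤ)) % (3 * Q : ℕ) = (Q * 1 : ℕ) :=
      Int.emod_eq_of_dvd_sub (by omega) (by omega) hd
    have hN' : (2 * ((n : ℤ) - Q)) % (3 * Q : ℕ) = 2 * Q :=
      Int.emod_eq_of_dvd_sub (by omega) (by omega)
        (by convert! hd.sub (dvd_refl _) using 1; push_cast; ring)
    have hc := Qpoly_coeff_eq_sub hP hQ one_pos hk (by omega) hR n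
    rw [hN, hN', binarySum_stepWindow_inter_cut hP hQ hk hT h1 h2,
      stepWindow_inter_cut_eq_empty h1 h2 (by omega), Set.indicator_empty'] at hc
    exact ⟨n, by rw [hc]; simp [binarySum]⟩
  · obtain ⟨n, h1, h2, hn⟩ := exists_two_mul_modEq_of_le (by omega) hPQR hR T 0
    have hd := hn.symm.dvd
    have hN : (2 * (n : ℤ)) % (3 * Q : ℕ) = 0 :=
      Int.emod_eq_of_dvd_sub (by omega) (by omega) hd
    have hN' : (2 * ((n : ℤ) - Q)) % (3 * Q : ℕ) = (Q * 1 : ℕ) :=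
      Int.emod_eq_of_dvd_sub (by omega) (by omega)
        (by convert! hd.sub (dvd_refl _) using 1; push_cast; ring)
    have hc := Qpoly_coeff_eq_sub hP hQ one_pos hk (by omega) hR n
    have hF := binarySum_indicator_stepWindow_eq hP hQ one_pos hk (by omega) hR n
    rw [hN, hN'] at hc hF
    rw [binarySum_stepWindow_inter_cut hP hQ hk hT h1 h2,
      stepWindow_inter_cut_eq_self h1 h2 (by omega), hF, hfull] at hc
    exact ⟨n, by rw [hc]; norm_num⟩

theorem coeff_mem_coeffSet {R n : ℕ} (hP : 0 < P) (hQ : 0 < Q) (hR : 0 < R)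
    (h : (Qpoly P Q R).coeff n ≠ 0) : (Qpoly P Q R).coeff n ∈ coeffSet P Q R :=
  ⟨n, natDegree_Qpoly hP hQ hR ▸ le_natDegree_of_ne_zero h, rfl⟩

theorem exists_isGreatest_isLeast_coeffSet {R : ℕ} (hP : P = 2 * l + 1) (hQ : Q = k * P + 2)
    (hl : 0 < l) (hk : 0 < k) (hPQR : P * Q ≤ R) (hR : 2 * R ≡ 1 [MOD P * Q]) :
    ∃ M m : ℤ, IsGreatest (coeffSet P Q R) M ∧ IsLeast (coeffSet P Q R) m ∧ M - m = P := by
  have hR0 : 0 < R := (Nat.mul_pos (by omega) (by omega)).trans_le hPQR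
  have key : ∀ M m : ℤ, M ≠ 0 → m ≠ 0 → M - m = P →
      (∀ n, (Qpoly P Q R).coeff n ∈ Set.Icc m M) →
      ((∃ n, (Qpoly P Q R).coeff n = m) ∧ ∃ n, (Qpoly P Q R).coeff n = M) →
      ∃ M m : ℤ, IsGreatest (coeffSet P Q R) M ∧ IsLeast (coeffSet P Q R) m ∧ M - m = P := by
    rintro M m hM hm hMm hb ⟨⟨i, rfl⟩, j, rfl⟩
    refine ⟨_, _, ⟨coeff_mem_coeffSet (by omega) (by omega) hR0 hM, ?_⟩,
      ⟨coeff_mem_coeffSet (by omega) (by omega) hR0 hm, ?_⟩, hMm⟩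
    · rintro _ ⟨n, -, rfl⟩
      exact (hb n).2
    · rintro _ ⟨n, -, rfl⟩
      exact (hb n).1
  obtain rfl | hl : l = 1 ∨ 2 ≤ l := by omega
  · subst hP
    exact key 2 (-1) (by norm_num) (by norm_num) (by norm_num)
      (Qpoly_three_coeff_mem_Icc hQ hk hR0 hR) (exists_Qpoly_three_coeff_eq_extremes hQ hk hPQR hR)
  · exact key l (-(l + 1)) (by omega) (by omega) (by rw [hP]; push_cast; ring)
      (Qpoly_coeff_mem_Icc hP hQ hl hk hR0 hR) (exists_Qpoly_coeff_eq_extremes hP hQ hl hk hPQR hR)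

end binarySum

theorem stmt_19 (p q r : ℕ) (hp : p.Prime) (hq : q.Prime) (hr : r.Prime)
    (hlt : p < q) (h8 : p % 8 = q % 8) (h8' : p % 8 = 3 ∨ p % 8 = 7)
    (hgcd : Nat.gcd (p - 1) (q - 1) = 2)
    (hqroot : IsPrimRootMod q (p ^ 2))
    (hrroot1 : IsPrimRootMod r (p ^ 2)) (hrroot2 : IsPrimRootMod r (q ^ 2)) :
    ∀ a : ℕ, 1 ≤ a → ∃ b c : ℕ, 0 < b ∧ 0 < c ∧
      2 < p ^ a ∧ 2 < q ^ b ∧ 2 < r ^ c ∧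
      ∃ M m : ℤ, IsGreatest (coeffSet (p ^ a) (q ^ b) (r ^ c)) M ∧
        IsLeast (coeffSet (p ^ a) (q ^ b) (r ^ c)) m ∧ M - m = (p : ℤ) ^ a := by
  intro a ha
  have hp2 : p ≠ 2 := by omega
  have hq2 : q ≠ 2 := by omega
  obtain ⟨b, k, hb, hk, hQ⟩ := exists_prime_pow_eq_mul_add_two hp hq hp2 hq2 ha hqroot
  have hqp : ¬ q ≡ 1 [MOD p] :=
    IsPrimRootMod.not_modEq_one hp hp2 (by simpa using hqroot.prime_pow hp hp2 (n := 1))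
  obtain ⟨c, hc, hPQR, hR⟩ := exists_large_pow_two_mul_modEq_one hp hq hr hlt h8 h8' hgcd hqp
    hrroot1 hrroot2 ha hb
  have hP3 : 3 ≤ p ^ a := (show 3 ≤ p by omega).trans (Nat.le_self_pow (by omega) p)
  obtain ⟨l, hl⟩ := (hp.odd_of_ne_two hp2).pow (n := a)
  have hQ3 : p ^ a + 2 ≤ q ^ b :=
    hQ ▸ Nat.add_le_add_right (Nat.le_mul_of_pos_left _ hk.pos) 2
  refine ⟨b, c, hb, hc, by omega, by omega,
    lt_of_lt_of_le (by omega) ((Nat.le_mul_of_pos_left (q ^ b) (by omega)).trans hPQR), ?_⟩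
  exact_mod_cast exists_isGreatest_isLeast_coeffSet hl hQ (by omega) hk.pos hPQR hR
end
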